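/- arXiv:1210.4391 — 3 statements merged into one kernel-verified Lean document; each statement's English description precedes it below -/
import Mathlib

section
/- Fix 1 < p < ∞ and let φ be a non-trivial weight on (0, ∞). Let ρ := ρ_{p,φ} and for s > 0 set h_ρ(s) := sup{ρ(f(·/s))/ρ(f) : 0 ≠ f ∈ M₊((0,∞))}. Then there exist constants c, C > 0 independent of s such that for all s > 0: c·A(s) ≤ h_ρ(s) ≤ C·A(s), where A(s) := sup_{t>0} [(∫₀^{st} φ(y) dy + sᵖtᵖ ∫_{st}^∞ φ(y) y^{-p} dy)/(∫₀^{t} φ(y) dy + tᵖ ∫_{t}^∞ φ(y) y^{-p} dy)]^{1/p}. -/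
open MeasureTheory Set ENNReal Filter

noncomputable section

/-- The interval `I_b = (0, b)` for `b ∈ (0, ∞]`, as a subset of `ℝ`. -/
def IbSet (b : ℝ≥0∞) : Set ℝ := {t : ℝ | 0 < t ∧ ENNReal.ofReal t < b}

/-- `∫₀ᵗ φ`. -/
def intPhi (φ : ℝ → ℝ≥0∞) (t : ℝ) : ℝ≥0∞ := ∫⁻ s in Ioo (0 : ℝ) t, φ s

/-- `∫ₜᵇ φ(s) s^(-p) ds`. -/
def tailP (b : ℝ≥0∞) (p : ℝ) (φ : ℝ → ℝ≥0∞) (t : ℝ) : ℝ≥0∞ :=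
  ∫⁻ s in {s : ℝ | t < s ∧ ENNReal.ofReal s < b}, φ s * ENNReal.ofReal (s ^ (-p))

/-- `∫₀ᵗ φ + tᵖ ∫ₜᵇ φ(s) s^(-p) ds`. -/
def DPhi (b : ℝ≥0∞) (p : ℝ) (φ : ℝ → ℝ≥0∞) (t : ℝ) : ℝ≥0∞ :=
  intPhi φ t + ENNReal.ofReal (t ^ p) * tailP b p φ t

/-- The Hardy averaging operator `P`. -/
def Pavg (g : ℝ → ℝ≥0∞) (t : ℝ) : ℝ≥0∞ := (ENNReal.ofReal t)⁻¹ * ∫⁻ s in Ioo (0 : ℝ) t, g s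

/-- The dual Hardy operator `Q`, `(Qg)(t) = ∫ₜᵇ g(s) s⁻¹ ds`. -/
def Qavg (b : ℝ≥0∞) (g : ℝ → ℝ≥0∞) (t : ℝ) : ℝ≥0∞ :=
  ∫⁻ s in {s : ℝ | t < s ∧ ENNReal.ofReal s < b}, g s * (ENNReal.ofReal s)⁻¹

/-- The operator `Q_p`, `(Q_p g)(t) = p t^(p-1) ∫ₜᵇ g(s) s^(-p) ds`. -/
def Qp (b : ℝ≥0∞) (p : ℝ) (g : ℝ → ℝ≥0∞) (t : ℝ) : ℝ≥0∞ :=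
  ENNReal.ofReal (p * t ^ (p - 1)) *
    ∫⁻ s in {s : ℝ | t < s ∧ ENNReal.ofReal s < b}, g s * ENNReal.ofReal (s ^ (-p))

/-- `(PQ_p)(φ)(t) = t⁻¹ [∫₀ᵗ φ + tᵖ ∫ₜᵇ φ(s) s^(-p) ds]`. -/
def PQp (b : ℝ≥0∞) (p : ℝ) (φ : ℝ → ℝ≥0∞) (t : ℝ) : ℝ≥0∞ :=
  (ENNReal.ofReal t)⁻¹ * DPhi b p φ t

/-- A weight on `I_b`: a positive, finite, locally integrable function. -/
def IsWeight (b : ℝ≥0∞) (φ : ℝ → ℝ≥0∞) : Prop :=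
  Measurable φ ∧ (∀ t ∈ IbSet b, 0 < φ t ∧ φ t < ⊤) ∧
    ∀ a c : ℝ, 0 < a → ENNReal.ofReal c < b → ∫⁻ t in Icc a c, φ t < ⊤

/-- A non-trivial weight on `I_b` for the index `p`. -/
def IsNontrivialWeight (b : ℝ≥0∞) (p : ℝ) (φ : ℝ → ℝ≥0∞) : Prop :=
  IsWeight b φ ∧
    (b = ⊤ → ∫⁻ t in Ioi (1 : ℝ), φ t * ENNReal.ofReal (t ^ (-p)) < ⊤) ∧
    tailP b p φ 0 = ⊤

/-- The dual weight `ψ(t) = t^(p+p'-1) (∫₀ᵗ φ)(∫ₜᵇ φ(s)s^(-p) ds)/D(t)^(p'+1)`. -/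
def dualWeight (b : ℝ≥0∞) (p : ℝ) (φ : ℝ → ℝ≥0∞) (t : ℝ) : ℝ≥0∞ :=
  ENNReal.ofReal (t ^ (p + p / (p - 1) - 1)) * intPhi φ t * tailP b p φ t /
    (DPhi b p φ t) ^ (p / (p - 1) + 1)

/-- `ψ = (Pφ)(Q_pφ)/[(PQ_p)(φ)]^(p'+1)`. -/
def dualWeight' (b : ℝ≥0∞) (p : ℝ) (φ : ℝ → ℝ≥0∞) (t : ℝ) : ℝ≥0∞ :=
  Pavg φ t * Qp b p φ t / (PQp b p φ t) ^ (p / (p - 1) + 1)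

/-- The decreasing rearrangement `f*`. -/
def decRearr {α : Type*} [MeasurableSpace α] (μ : Measure α) (f : α → ℝ) (t : ℝ) : ℝ≥0∞ :=
  sInf {l : ℝ≥0∞ | μ {x | l < (‖f x‖₊ : ℝ≥0∞)} ≤ ENNReal.ofReal t}

/-- `f**(t) = t⁻¹ ∫₀ᵗ f*`. -/
def avgRearr {α : Type*} [MeasurableSpace α] (μ : Measure α) (f : α → ℝ) (t : ℝ) : ℝ≥0∞ :=
  (ENNReal.ofReal t)⁻¹ * ∫⁻ s in Ioo (0 : ℝ) t, decRearr μ f s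

/-- The Lorentz Gamma functional `ρ_{p,φ}(f) = (∫_{I_b} f**(t)^p φ(t) dt)^(1/p)`. -/
def rhoGamma {α : Type*} [MeasurableSpace α] (μ : Measure α) (b : ℝ≥0∞) (p : ℝ)
    (φ : ℝ → ℝ≥0∞) (f : α → ℝ) : ℝ≥0∞ :=
  (∫⁻ t in IbSet b, (avgRearr μ f t) ^ p * φ t) ^ (1 / p)

/-- The Stieltjes operator `(Sg)(t) = ∫₀^∞ g(s)/(s+t) ds`. -/
def Sop (g : ℝ → ℝ≥0∞) (t : ℝ) : ℝ≥0∞ :=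
  ∫⁻ s in Ioi (0 : ℝ), g s / ENNReal.ofReal (s + t)

/-- Lebesgue measure on `(0,∞)`. -/
def mu0 : Measure ℝ := volume.restrict (Ioi (0 : ℝ))
theorem lem_chain (p : ℝ) (hp : 1 < p) (h : ℝ → ℝ≥0∞) (hh : Antitone h)
    (hX : ∀ t, 0 < t → ∫⁻ s in Ioo (0 : ℝ) t, h s ≠ ⊤) (t : ℝ) (ht : 0 < t) :
    (∫⁻ s in Ioo (0 : ℝ) t, h s) ^ p =
      ∫⁻ r in Ioo (0 : ℝ) t, ENNReal.ofReal p * (∫⁻ s in Ioo (0 : ℝ) r, h s) ^ (p - 1) * h r := by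
  have hfin : ∀ r, 0 < r → h r ≠ ⊤ := by
    intro r hr htop
    apply hX r hr
    rw [eq_top_iff]
    calc (⊤ : ℝ≥0∞) = ∫⁻ s in Ioo (0 : ℝ) r, ⊤ := by
          simp [ENNReal.top_mul, hr]
      _ ≤ _ := by
          apply setLIntegral_mono' measurableSet_Ioo
          intro s hs
          rw [← htop]; exact hh hs.2.le
  set u : ℝ → ℝ := fun r => (h r).toReal with hu
  have hmeas : Measurable h := hh.measurable
  have humeas : Measurable u := hmeas.ennreal_toReal
  have hofu : ∀ r, 0 < r → ENNReal.ofReal (u r) = h r := fun r hr => ENNReal.ofReal_toReal (hfin r hr)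
  have hintg : ∀ r, 0 < r → IntegrableOn u (Ioo 0 r) := by
    intro r hr
    refine integrable_toReal_of_lintegral_ne_top hmeas.aemeasurable (hX r hr)
  have hii : ∀ r, 0 < r → IntervalIntegrable u volume 0 r := by
    intro r hr
    rw [intervalIntegrable_iff_integrableOn_Ioo_of_le hr.le]; exact hintg r hr
  set x : ℝ → ℝ := fun r => ∫ s in (0 : ℝ)..r, u s with hx
  have hx0 : ∀ r, 0 ≤ r → 0 ≤ x r := fun r hr =>
    intervalIntegral.integral_nonneg hr (fun s _ => ENNReal.toReal_nonneg)
  have hxX : ∀ r, 0 < r → ENNReal.ofReal (x r) = ∫⁻ s in Ioo (0 : ℝ) r, h s := by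
    intro r hr
    simp only [hx]
    rw [intervalIntegral.integral_of_le hr.le, integral_Ioc_eq_integral_Ioo,
      ofReal_integral_eq_lintegral_ofReal (hintg r hr) (Eventually.of_forall fun s => ENNReal.toReal_nonneg)]
    exact setLIntegral_congr_fun measurableSet_Ioo (fun s hs => hofu s hs.1)
  have hxcont : ContinuousOn x (Icc 0 t) := by
    have := intervalIntegral.continuousOn_primitive_interval (f := u) (μ := volume) (a := 0) (b := t)
      (by rw [uIcc_of_le ht.le, integrableOn_Icc_iff_integrableOn_Ioo]; exact hintg t ht)
    rwa [uIcc_of_le ht.le] at this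
  have hderiv : ∀ r ∈ Ioo (0:ℝ) t \ {r | ¬ ContinuousAt h r}, 
      HasDerivAt (fun r => x r ^ p) (p * x r ^ (p - 1) * u r) r := by
    rintro r ⟨hr, hc⟩
    have hc : ContinuousAt h r := by simpa using hc
    have hcu : ContinuousAt u r := (ENNReal.continuousAt_toReal (hfin r hr.1)).comp hc
    have h1 : HasDerivAt x (u r) r :=
      intervalIntegral.integral_hasDerivAt_right (hii r hr.1)
        (humeas.stronglyMeasurable.stronglyMeasurableAtFilter) hcu
    have := h1.rpow_const (p := p) (Or.inr hp.le)
    convert this using 1; ring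
  have hcont2 : ContinuousOn (fun r => x r ^ (p-1)) (Icc 0 t) :=
    hxcont.rpow_const (fun r _ => Or.inr (by linarith))
  have hint2 : IntegrableOn (fun r => p * x r ^ (p - 1) * u r) (Icc 0 t) := by
    have h1 : IntegrableOn u (Icc 0 t) := by
      rw [integrableOn_Icc_iff_integrableOn_Ioo]; exact hintg t ht
    exact h1.continuousOn_mul (hcont2.const_smul p) isCompact_Icc
  have hftc : ∫ r in (0:ℝ)..t, p * x r ^ (p - 1) * u r = x t ^ p - x 0 ^ p := by
    apply integral_eq_of_hasDerivAt_off_countable_of_le (fun r => x r ^ p) _ ht.le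
      (s := {r | ¬ ContinuousAt h r}) hh.countable_not_continuousAt
      (hxcont.rpow_const (fun r _ => Or.inr (by linarith))) hderiv
    rw [intervalIntegrable_iff_integrableOn_Icc_of_le ht.le]; exact hint2
  have hx00 : x 0 = 0 := by simp [hx]
  rw [hx00, Real.zero_rpow (by linarith), sub_zero, intervalIntegral.integral_of_le ht.le, integral_Ioc_eq_integral_Ioo] at hftc
  rw [← hxX t ht, ENNReal.ofReal_rpow_of_nonneg (hx0 t ht.le) (by linarith), ← hftc,
    ofReal_integral_eq_lintegral_ofReal (hint2.mono_set Ioo_subset_Icc_self)]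
  · refine setLIntegral_congr_fun measurableSet_Ioo (fun r hr => ?_)
    have := hx0 r hr.1.le
    rw [ENNReal.ofReal_mul (by positivity), ENNReal.ofReal_mul (by linarith), hofu r hr.1, ← hxX r hr.1,
      ENNReal.ofReal_rpow_of_nonneg this (by linarith)]
  · filter_upwards [ae_restrict_mem measurableSet_Ioo] with r hr
    have := hx0 r hr.1.le
    have : 0 ≤ u r := ENNReal.toReal_nonneg
    simp only [Pi.zero_apply]; positivity

/-- kernel -/
def kker (p t r : ℝ) : ℝ≥0∞ := if 0 < r ∧ r < t then ENNReal.ofReal (p * r ^ (p - 1) * t ^ (-p)) else 0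

theorem kker_meas (p s : ℝ) : Measurable (fun z : ℝ × ℝ => kker p (z.1 / s) z.2) := by
  unfold kker
  refine Measurable.ite ?_ ?_ measurable_const
  · exact (measurableSet_lt measurable_const measurable_snd).inter
      (measurableSet_lt measurable_snd (measurable_fst.div_const s))
  · fun_prop

theorem kker_int (p : ℝ) (hp : 1 < p) (t R : ℝ) (ht : 0 < t) (hR : 0 < R) :
    ∫⁻ r in Ioo 0 R, kker p t r = ENNReal.ofReal ((min t R) ^ p * t ^ (-p)) := by
  set m := min t R with hm
  have hm0 : 0 < m := lt_min ht hR
  have e1 : ∫⁻ r in Ioo 0 R, kker p t r = ∫⁻ r in Ioo 0 m, ENNReal.ofReal (p * r ^ (p - 1) * t ^ (-p)) := by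
    rw [← lintegral_indicator measurableSet_Ioo, ← lintegral_indicator measurableSet_Ioo]
    congr 1; ext r
    simp only [indicator, kker, mem_Ioo, hm, lt_min_iff]
    split_ifs <;> first | rfl | tauto
  have hI : IntervalIntegrable (fun r : ℝ => p * r ^ (p - 1) * t ^ (-p)) volume 0 m :=
    ((intervalIntegral.intervalIntegrable_rpow' (by linarith)).const_mul p).mul_const _
  rw [e1, ← ofReal_integral_eq_lintegral_ofReal, ← integral_Ioc_eq_integral_Ioo,
    ← intervalIntegral.integral_of_le hm0.le]
  · rw [intervalIntegral.integral_mul_const, intervalIntegral.integral_const_mul, integral_rpow (Or.inl (by linarith))]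
    congr 2
    rw [sub_add_cancel, Real.zero_rpow (by linarith)]
    field_simp; ring
  · rwa [intervalIntegrable_iff_integrableOn_Ioo_of_le hm0.le] at hI
  · filter_upwards [ae_restrict_mem measurableSet_Ioo] with r hr
    have := hr.1
    simp only [Pi.zero_apply]; positivity

theorem IbSet_top : IbSet ⊤ = Ioi 0 := by ext; simp [IbSet]
theorem tset_top (t : ℝ) : {s : ℝ | t < s ∧ ENNReal.ofReal s < ⊤} = Ioi t := by ext; simp

theorem D_form (p : ℝ) (φ : ℝ → ℝ≥0∞) (hφ : Measurable φ) (a : ℝ) (ha : 0 < a) :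
    intPhi φ a + ENNReal.ofReal (a ^ p) * tailP ⊤ p φ a =
      ∫⁻ t in Ioi 0, ENNReal.ofReal ((min t a) ^ p * t ^ (-p)) * φ t := by
  rw [← Ioc_union_Ioi_eq_Ioi ha.le, lintegral_union measurableSet_Ioi (by
    rw [Set.disjoint_left]; intro x hx hx'; exact absurd hx.2 (not_le.2 hx'))]
  congr 1
  · rw [intPhi, setLIntegral_congr (Ioo_ae_eq_Ioc (a := (0:ℝ)) (b := a))]
    refine setLIntegral_congr_fun measurableSet_Ioc (fun r hr => ?_)
    rw [min_eq_left hr.2, ← Real.rpow_add hr.1]; simp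
  · rw [tailP, tset_top, ← lintegral_const_mul _ (by fun_prop)]
    refine setLIntegral_congr_fun measurableSet_Ioi (fun r hr => ?_)
    rw [min_eq_right (le_of_lt hr), ENNReal.ofReal_mul (by positivity)]
    ring

theorem antitone_compare (μ ν : Measure ℝ) (K : ℝ≥0∞) 
    (hμ : μ (Iic 0) = 0) (hν : ν (Iic 0) = 0) (hμa : ∀ x, μ {x} = 0)
    (hle : ∀ R, 0 < R → μ (Ioo 0 R) ≤ K * ν (Ioo 0 R))
    (g : ℝ → ℝ≥0∞) (hg : Measurable g) (hga : AntitoneOn g (Ioi 0)) (hgf : ∀ r, 0 < r → g r ≠ ⊤) :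
    ∫⁻ r, g r ∂μ ≤ K * ∫⁻ r, g r ∂ν := by
  have hae : ∀ (μ : Measure ℝ), μ (Iic 0) = 0 → ∀ᵐ r ∂μ, 0 < r := by
    intro μ h
    rw [ae_iff]; convert h using 2; ext; simp
  have hrep : ∀ (μ : Measure ℝ), μ (Iic 0) = 0 → ∫⁻ r, g r ∂μ = ∫⁻ l in Ioi (0:ℝ), μ {r | l < (g r).toReal} := by
    intro μ h
    rw [← lintegral_eq_lintegral_meas_lt μ (Eventually.of_forall fun r => ENNReal.toReal_nonneg) hg.ennreal_toReal.aemeasurable]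
    apply lintegral_congr_ae
    filter_upwards [hae μ h] with r hr
    rw [ENNReal.ofReal_toReal (hgf r hr)]
  have hIoi : μ (Ioi 0) ≤ K * ν (Ioi 0) := by
    have e : Ioi (0:ℝ) = ⋃ n : ℕ, Ioo 0 ((n:ℝ) + 1) := by
      ext x; simp only [mem_Ioi, mem_iUnion, mem_Ioo]
      constructor
      · intro hx
        obtain ⟨n, hn⟩ := exists_nat_gt x
        exact ⟨n, hx, by linarith⟩
      · rintro ⟨n, h, _⟩; exact h
    have hmono : Monotone (fun n : ℕ => Ioo (0:ℝ) ((n:ℝ) + 1)) := by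
      intro a b hab
      apply Ioo_subset_Ioo_right
      have : (a:ℝ) ≤ b := by exact_mod_cast hab
      linarith
    rw [show μ (Ioi 0) = _ by rw [e, hmono.measure_iUnion]]
    apply iSup_le
    intro n
    exact (hle _ (by positivity)).trans (by gcongr; exact Ioo_subset_Ioi_self)
  rw [hrep μ hμ, hrep ν hν]
  refine (lintegral_mono (g := fun l : ℝ => K * ν {r | l < (g r).toReal}) fun l => ?_).trans_eq ?_
  · simp only
    set S := {r | l < (g r).toReal} with hS
    have hSm : ∀ (μ : Measure ℝ), μ (Iic 0) = 0 → μ S = μ (S ∩ Ioi 0) := by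
      intro μ h
      apply measure_congr
      filter_upwards [hae μ h] with r hr
      apply propext
      exact ⟨fun a => ⟨a, hr⟩, fun a => a.1⟩
    rw [hSm μ hμ, hSm ν hν]
    have hdown : ∀ r ∈ S ∩ Ioi 0, ∀ r', 0 < r' → r' ≤ r → r' ∈ S ∩ Ioi 0 := by
      intro r hr r' h0 h1
      refine ⟨?_, h0⟩
      have := hga (show r' ∈ Ioi 0 from h0) hr.2 h1
      exact lt_of_lt_of_le hr.1 (ENNReal.toReal_mono (hgf r' h0) this)
    by_cases hb : BddAbove (S ∩ Ioi 0)
    · rcases (S ∩ Ioi 0).eq_empty_or_nonempty with he | hne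
      · rw [he]; simp
      set R := sSup (S ∩ Ioi 0)
      have hR : 0 < R := by
        obtain ⟨r, hr⟩ := hne
        exact lt_of_lt_of_le hr.2 (le_csSup hb hr)
      have h1 : S ∩ Ioi 0 ⊆ Ioo 0 R ∪ {R} := by
        intro r hr
        have := le_csSup hb hr
        rcases this.lt_or_eq with h | h
        · left; exact ⟨hr.2, h⟩
        · right; exact h
      have h2 : Ioo 0 R ⊆ S ∩ Ioi 0 := by
        intro r hr
        obtain ⟨r', hr', hlt⟩ := exists_lt_of_lt_csSup hne hr.2
        exact hdown r' hr' r hr.1 hlt.le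
      calc μ (S ∩ Ioi 0) ≤ μ (Ioo 0 R ∪ {R}) := measure_mono h1
        _ ≤ μ (Ioo 0 R) + μ {R} := measure_union_le _ _
        _ = μ (Ioo 0 R) := by rw [hμa, add_zero]
        _ ≤ K * ν (Ioo 0 R) := hle R hR
        _ ≤ _ := by gcongr
    · have : S ∩ Ioi 0 = Ioi 0 := by
        apply Subset.antisymm inter_subset_right
        intro r hr
        rw [not_bddAbove_iff] at hb
        obtain ⟨r', hr', hlt⟩ := hb r
        exact hdown r' hr' r hr hlt.le
      rw [this]; exact hIoi
  · apply lintegral_const_mul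
    have : Antitone (fun l : ℝ => ν {r | l < (g r).toReal}) := by
      intro a b hab
      apply measure_mono
      intro r hr
      exact lt_of_le_of_lt hab hr
    exact this.measurable

theorem decRearr_anti (f : ℝ → ℝ) : Antitone (decRearr mu0 f) := by
  intro a b hab
  apply sInf_le_sInf
  intro l hl
  exact le_trans hl (ENNReal.ofReal_le_ofReal hab)

theorem mu0_dilate (s : ℝ) (hs : 0 < s) (S : Set ℝ) :
    mu0 ((fun x => x / s) ⁻¹' S) = ENNReal.ofReal s * mu0 S := by
  have e : (fun x : ℝ => x / s) = (fun x => s⁻¹ * x) := by ext; rw [div_eq_inv_mul]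
  have h1 : ((fun x : ℝ => s⁻¹ * x) ⁻¹' S) ∩ Ioi 0 = (fun x => s⁻¹ * x) ⁻¹' (S ∩ Ioi 0) := by
    ext x
    simp [hs]
  rw [mu0, Measure.restrict_apply' measurableSet_Ioi, Measure.restrict_apply' measurableSet_Ioi, e, h1,
    Real.volume_preimage_mul_left (by positivity)]
  simp [abs_of_pos hs]

theorem decRearr_dilate (s : ℝ) (hs : 0 < s) (f : ℝ → ℝ) (t : ℝ) :
    decRearr mu0 (fun x => f (x / s)) t = decRearr mu0 f (t / s) := by
  unfold decRearr
  congr 1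
  ext l
  have : {x | l < (‖f (x / s)‖₊ : ℝ≥0∞)} = (fun x => x / s) ⁻¹' {x | l < (‖f x‖₊ : ℝ≥0∞)} := rfl
  simp only [mem_ofPred_eq]
  rw [this, mu0_dilate s hs, ENNReal.ofReal_div_of_pos hs, ENNReal.le_div_iff_mul_le (by simp [hs]) (by simp), mul_comm]

theorem setLIntegral_dilate (s : ℝ) (hs : 0 < s) (h : ℝ → ℝ≥0∞) (hm : Measurable h) (t : ℝ) :
    ∫⁻ y in Ioo (0:ℝ) t, h (y / s) = ENNReal.ofReal s * ∫⁻ y in Ioo (0:ℝ) (t / s), h y := by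
  have hmap := Real.smul_map_volume_mul_left (a := s⁻¹) (by positivity)
  have e : ∀ y : ℝ, y / s = s⁻¹ * y := fun y => by rw [div_eq_inv_mul]
  rw [← lintegral_indicator measurableSet_Ioo, ← lintegral_indicator measurableSet_Ioo]
  have h2 : ∀ y, (Ioo (0:ℝ) t).indicator (fun y => h (y / s)) y = (Ioo (0:ℝ) (t/s)).indicator h (s⁻¹ * y) := by
    intro y
    rw [← e]
    simp only [indicator, mem_Ioo, div_lt_div_iff_of_pos_right hs]
    simp [hs]
  simp_rw [h2]
  rw [← lintegral_map (hm.indicator measurableSet_Ioo) (measurable_const_mul _)]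
  nth_rewrite 2 [← hmap]
  rw [lintegral_smul_measure, smul_eq_mul, ← mul_assoc, ← ENNReal.ofReal_mul hs.le, abs_of_pos (by positivity),
    mul_inv_cancel₀ hs.ne']
  simp

theorem avgRearr_dilate (s : ℝ) (hs : 0 < s) (f : ℝ → ℝ) (t : ℝ) :
    avgRearr mu0 (fun x => f (x / s)) t = avgRearr mu0 f (t / s) := by
  unfold avgRearr
  simp_rw [decRearr_dilate s hs]
  rw [setLIntegral_dilate s hs _ (decRearr_anti f).measurable, ← mul_assoc]
  congr 1
  rw [ENNReal.ofReal_div_of_pos hs, ENNReal.inv_div (by simp) (by simp [hs]), mul_comm]; rfl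

theorem decRearr_ind (a : ℝ) (y : ℝ) (hy : 0 < y) :
    decRearr mu0 ((Ioo 0 a).indicator (fun _ => (1:ℝ))) y = if y < a then 1 else 0 := by
  have hset : ∀ l : ℝ≥0∞, {x | l < (‖(Ioo 0 a).indicator (fun _ => (1:ℝ)) x‖₊ : ℝ≥0∞)} = if l < 1 then Ioo 0 a else ∅ := by
    intro l
    ext x
    by_cases hx : x ∈ Ioo 0 a <;> by_cases hl : l < 1 <;> simp_all
  have hmu : mu0 (Ioo 0 a) = ENNReal.ofReal a := by
    rw [mu0, Measure.restrict_apply' measurableSet_Ioi, inter_eq_left.2 Ioo_subset_Ioi_self]; simp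
  unfold decRearr
  simp_rw [hset]
  split_ifs with h
  · apply le_antisymm
    · apply sInf_le; simp
    · apply le_sInf
      intro l hl
      by_contra hlt
      rw [not_le] at hlt
      simp only [mem_ofPred_eq, if_pos hlt, hmu] at hl
      rw [ENNReal.ofReal_le_ofReal_iff hy.le] at hl
      linarith
  · rw [← nonpos_iff_eq_zero]
    apply sInf_le
    simp only [mem_ofPred_eq, zero_lt_one, if_true, hmu]
    exact ENNReal.ofReal_le_ofReal (not_lt.1 h)

theorem avgRearr_ind (a : ℝ) (ha : 0 < a) (y : ℝ) (hy : 0 < y) :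
    avgRearr mu0 ((Ioo 0 a).indicator (fun _ => (1:ℝ))) y = ENNReal.ofReal (min y a / y) := by
  unfold avgRearr
  have : ∫⁻ s in Ioo 0 y, decRearr mu0 ((Ioo 0 a).indicator (fun _ => (1:ℝ))) s = ENNReal.ofReal (min y a) := by
    rw [setLIntegral_congr_fun measurableSet_Ioo (fun s hs => decRearr_ind a s hs.1)]
    have : ∀ s, (if s < a then (1:ℝ≥0∞) else 0) = (Iio a).indicator 1 s := by
      intro s; simp [indicator]
    simp_rw [this]
    rw [lintegral_indicator_one measurableSet_Iio, Measure.restrict_apply measurableSet_Iio]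
    have : Iio a ∩ Ioo 0 y = Ioo 0 (min y a) := by ext; simp; tauto
    rw [this]; simp
  rw [this, ENNReal.ofReal_div_of_pos hy, mul_comm]; rfl

theorem rho_ind (p : ℝ) (hp : 1 < p) (φ : ℝ → ℝ≥0∞) (hφ : Measurable φ) (a : ℝ) (ha : 0 < a) :
    rhoGamma mu0 ⊤ p φ ((Ioo 0 a).indicator (fun _ => (1:ℝ))) =
      (intPhi φ a + ENNReal.ofReal (a ^ p) * tailP ⊤ p φ a) ^ (1 / p) := by
  rw [D_form p φ hφ a ha, rhoGamma, IbSet_top]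
  congr 1
  refine setLIntegral_congr_fun measurableSet_Ioi (fun r hr => ?_)
  have hr : 0 < r := hr
  have : 0 < min r a := lt_min hr ha
  beta_reduce
  rw [avgRearr_ind a ha r hr, ENNReal.ofReal_rpow_of_nonneg (by positivity) (by linarith),
    Real.div_rpow this.le hr.le, Real.rpow_neg hr.le]
  rfl

theorem avgRearr_rep (p : ℝ) (hp : 1 < p) (f : ℝ → ℝ)
    (hX : ∀ t, 0 < t → ∫⁻ s in Ioo (0 : ℝ) t, decRearr mu0 f s ≠ ⊤) (t : ℝ) (ht : 0 < t) :
    avgRearr mu0 f t ^ p = ∫⁻ r in Ioi 0, kker p t r * (avgRearr mu0 f r ^ (p - 1) * decRearr mu0 f r) := by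
  have e1 : ∫⁻ r in Ioi 0, kker p t r * (avgRearr mu0 f r ^ (p - 1) * decRearr mu0 f r) =
      ∫⁻ r in Ioo 0 t, ENNReal.ofReal (p * r ^ (p - 1) * t ^ (-p)) * (avgRearr mu0 f r ^ (p - 1) * decRearr mu0 f r) := by
    rw [← lintegral_indicator measurableSet_Ioo, ← lintegral_indicator measurableSet_Ioi]
    congr 1; ext r
    by_cases h0 : 0 < r <;> by_cases h1 : r < t <;> simp [indicator, kker, h0, h1]
  rw [e1]
  have e2 : avgRearr mu0 f t ^ p = ENNReal.ofReal (t ^ (-p)) * (∫⁻ s in Ioo (0 : ℝ) t, decRearr mu0 f s) ^ p := by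
    rw [avgRearr, ENNReal.mul_rpow_of_nonneg _ _ (by linarith), ← ENNReal.ofReal_inv_of_pos ht,
      ENNReal.ofReal_rpow_of_pos (by positivity), Real.inv_rpow ht.le, Real.rpow_neg ht.le]
  rw [e2, lem_chain p hp _ (decRearr_anti f) hX t ht, ← lintegral_const_mul' _ _ ENNReal.ofReal_ne_top]
  refine setLIntegral_congr_fun measurableSet_Ioo (fun r hr => ?_)
  have hr := hr.1
  beta_reduce
  rw [avgRearr, ENNReal.mul_rpow_of_nonneg _ _ (by linarith), ← ENNReal.ofReal_inv_of_pos hr,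
      ENNReal.ofReal_rpow_of_pos (by positivity), Real.inv_rpow hr.le,
      ENNReal.ofReal_mul (by positivity), ENNReal.ofReal_mul (by positivity)]
  have : ENNReal.ofReal (r ^ (p-1)) * ENNReal.ofReal ((r ^ (p-1))⁻¹) = 1 := by
    rw [← ENNReal.ofReal_mul (by positivity), mul_inv_cancel₀ (by positivity)]; simp
  set A := ENNReal.ofReal (r ^ (p-1))
  set B := ENNReal.ofReal ((r ^ (p-1))⁻¹)
  set T := ENNReal.ofReal (t ^ (-p))
  set P := ENNReal.ofReal p
  set X := (∫⁻ s in Ioo (0 : ℝ) r, decRearr mu0 f s) ^ (p-1)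
  set H := decRearr mu0 f r
  calc T * (P * X * H) = T * (P * X * H) * 1 := by ring
    _ = T * (P * X * H) * (A * B) := by rw [this]
    _ = _ := by ring

theorem avgRearr_antiOn (f : ℝ → ℝ) : AntitoneOn (avgRearr mu0 f) (Ioi 0) := by
  intro a ha b hb hab
  have ha : 0 < a := ha
  have hb : 0 < b := hb
  have hs : 1 ≤ b / a := (one_le_div ha).2 hab
  have hs0 : 0 < b / a := by positivity
  have h1 := avgRearr_dilate (b / a) hs0 f b
  have : b / (b / a) = a := by field_simp
  rw [this] at h1
  rw [← h1]
  unfold avgRearr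
  simp_rw [decRearr_dilate (b/a) hs0]
  refine mul_le_mul_right ?_ _
  apply lintegral_mono_ae
  filter_upwards [ae_restrict_mem measurableSet_Ioo] with s hs'
  exact decRearr_anti f (div_le_self hs'.1.le hs)

theorem avgRearr_meas (f : ℝ → ℝ) : Measurable (avgRearr mu0 f) := by
  unfold avgRearr
  apply Measurable.mul (by fun_prop)
  apply Monotone.measurable
  intro a b hab
  exact lintegral_mono_set (Ioo_subset_Ioo_right hab)

/-- measure -/
def muS (p : ℝ) (φ : ℝ → ℝ≥0∞) (s : ℝ) : Measure ℝ :=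
  (volume.restrict (Ioi 0)).withDensity (fun r => ∫⁻ t in Ioi 0, kker p (t / s) r * φ t)

theorem rho_rep (p : ℝ) (hp : 1 < p) (φ : ℝ → ℝ≥0∞) (hφ : Measurable φ) (f : ℝ → ℝ)
    (hX : ∀ t, 0 < t → ∫⁻ s in Ioo (0 : ℝ) t, decRearr mu0 f s ≠ ⊤) (s : ℝ) (hs : 0 < s) :
    ∫⁻ t in Ioi 0, avgRearr mu0 f (t / s) ^ p * φ t =
      ∫⁻ r, (avgRearr mu0 f r ^ (p - 1) * decRearr mu0 f r) ∂(muS p φ s) := by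
  have hgm : Measurable (fun r => avgRearr mu0 f r ^ (p - 1) * decRearr mu0 f r) :=
    ((avgRearr_meas f).pow_const _).mul (decRearr_anti f).measurable
  set g := (fun r => avgRearr mu0 f r ^ (p - 1) * decRearr mu0 f r) with hg
  have hkm : Measurable (fun z : ℝ × ℝ => kker p (z.1 / s) z.2 * φ z.1) :=
    (kker_meas p s).mul (hφ.comp measurable_fst)
  have hW : Measurable (fun r => ∫⁻ t in Ioi 0, kker p (t / s) r * φ t) :=
    Measurable.lintegral_prod_left' hkm
  rw [muS, lintegral_withDensity_eq_lintegral_mul _ hW hgm]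
  have e1 : ∫⁻ t in Ioi 0, avgRearr mu0 f (t / s) ^ p * φ t =
      ∫⁻ t in Ioi 0, ∫⁻ r in Ioi 0, kker p (t / s) r * φ t * g r := by
    refine setLIntegral_congr_fun measurableSet_Ioi (fun t ht => ?_)
    beta_reduce
    have ht : 0 < t := ht
    rw [avgRearr_rep p hp f hX (t / s) (by positivity), mul_comm, ← lintegral_const_mul]
    · apply lintegral_congr; intro r; simp only [hg]; ring
    · exact (((kker_meas p s).comp (measurable_prodMk_left (x := t)))).mul hgm
  rw [e1, lintegral_lintegral_swap]
  · apply lintegral_congr; intro r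
    rw [lintegral_mul_const]
    · rfl
    · exact hkm.comp (measurable_id.prodMk measurable_const)
  · exact (hkm.mul (hgm.comp measurable_snd)).aemeasurable

theorem muS_Ioo (p : ℝ) (hp : 1 < p) (φ : ℝ → ℝ≥0∞) (hφ : Measurable φ) (s : ℝ) (hs : 0 < s)
    (R : ℝ) (hR : 0 < R) : muS p φ s (Ioo 0 R) = 
    intPhi φ (s * R) + ENNReal.ofReal ((s * R) ^ p) * tailP ⊤ p φ (s * R) := by
  have hkm : Measurable (fun z : ℝ × ℝ => kker p (z.1 / s) z.2 * φ z.1) :=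
    (kker_meas p s).mul (hφ.comp measurable_fst)
  rw [D_form p φ hφ (s * R) (by positivity), muS, withDensity_apply _ measurableSet_Ioo,
    Measure.restrict_restrict measurableSet_Ioo, inter_eq_left.2 Ioo_subset_Ioi_self,
    lintegral_lintegral_swap]
  · refine setLIntegral_congr_fun measurableSet_Ioi (fun t ht => ?_)
    beta_reduce
    have ht : 0 < t := ht
    rw [lintegral_mul_const, kker_int p hp (t/s) R (by positivity) hR]
    · congr 2
      have : min (t / s) R = min t (s * R) / s := by
        rw [← min_div_div_right hs.le, mul_div_cancel_left₀ _ hs.ne']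
      have h0 : 0 < min t (s * R) := lt_min ht (by positivity)
      rw [this, Real.div_rpow h0.le hs.le, Real.div_rpow ht.le hs.le, Real.rpow_neg hs.le]
      field_simp
    · exact ((kker_meas p s).comp (measurable_prodMk_left (x := t)))
  · exact (hkm.comp measurable_swap).aemeasurable

theorem decRearr_le_avg (f : ℝ → ℝ) (r : ℝ) (hr : 0 < r) : decRearr mu0 f r ≤ avgRearr mu0 f r := by
  unfold avgRearr
  have : ∫⁻ s in Ioo 0 r, decRearr mu0 f r ≤ ∫⁻ s in Ioo 0 r, decRearr mu0 f s :=
    setLIntegral_mono' measurableSet_Ioo (fun s hs => decRearr_anti f hs.2.le)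
  rw [setLIntegral_const, Real.volume_Ioo, sub_zero] at this
  calc decRearr mu0 f r = (ENNReal.ofReal r)⁻¹ * (decRearr mu0 f r * ENNReal.ofReal r) := by
        rw [mul_comm (decRearr mu0 f r), ← mul_assoc, ENNReal.inv_mul_cancel (by simp [hr]) (by simp), one_mul]
    _ ≤ _ := by gcongr

theorem avg_one_ne_zero (f : ℝ → ℝ) (hf : ¬ f =ᵐ[mu0] 0) : avgRearr mu0 f 1 ≠ 0 := by
  intro h0
  apply hf
  unfold avgRearr at h0
  simp only [ENNReal.ofReal_one, inv_one, one_mul] at h0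
  rw [lintegral_eq_zero_iff (decRearr_anti f).measurable] at h0
  have hz : ∀ y, 0 < y → decRearr mu0 f y = 0 := by
    intro y hy
    by_contra hne
    have hsub : ∀ᵐ x ∂(volume.restrict (Ioo (0:ℝ) 1)), y < x := by
      filter_upwards [h0] with x hx
      by_contra hlt
      rw [not_lt] at hlt
      have := decRearr_anti f hlt
      rw [hx] at this
      exact hne (nonpos_iff_eq_zero.1 this)
    rw [ae_restrict_iff' measurableSet_Ioo, ae_iff] at hsub
    have h2 : Ioo (0:ℝ) (min y 1) ⊆ {a | ¬(a ∈ Ioo (0:ℝ) 1 → y < a)} := by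
      intro a ha
      have h3 := ha.1
      have h4 := lt_min_iff.1 ha.2
      simp only [mem_ofPred_eq, Classical.not_imp, not_lt]
      exact ⟨⟨h3, h4.2⟩, h4.1.le⟩
    have h5 := measure_mono_null h2 hsub
    rw [Real.volume_Ioo, ENNReal.ofReal_eq_zero] at h5
    have : 0 < min y 1 := lt_min hy one_pos
    linarith
  have hl : ∀ l : ℝ≥0∞, 0 < l → mu0 {x | l < (‖f x‖₊ : ℝ≥0∞)} = 0 := by
    intro l hl
    by_contra hne
    obtain ⟨y, hy0, hy⟩ := ENNReal.lt_iff_exists_nnreal_btwn.1 (pos_iff_ne_zero.2 hne)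
    have h1 := hz y (by exact_mod_cast hy0)
    unfold decRearr at h1
    obtain ⟨l', hl', hlt⟩ := sInf_lt_iff.1 (h1 ▸ hl)
    have : mu0 {x | l < (‖f x‖₊ : ℝ≥0∞)} ≤ ENNReal.ofReal y := by
      refine le_trans (measure_mono ?_) hl'
      intro x hx
      exact lt_trans hlt hx
    rw [ENNReal.ofReal_coe_nnreal] at this
    exact absurd hy (not_lt.2 this)
  have hn : ∀ᵐ x ∂mu0, ∀ n : ℕ, (‖f x‖₊ : ℝ≥0∞) ≤ (n : ℝ≥0∞)⁻¹ := by
    rw [ae_all_iff]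
    intro n
    rw [ae_iff]
    simp only [not_le]
    exact hl _ (by simp)
  filter_upwards [hn] with x hx
  by_contra hne
  have h3 : (‖f x‖₊ : ℝ≥0∞) ≠ 0 := by simpa using hne
  obtain ⟨n, hn⟩ := ENNReal.exists_inv_nat_lt h3
  exact absurd (hx n) (not_le.2 hn)

theorem upper_aux (p : ℝ) (hp : 1 < p) (φ : ℝ → ℝ≥0∞) (hφ : IsNontrivialWeight ⊤ p φ) (s : ℝ) (hs : 0 < s)
    (f : ℝ → ℝ) (hf : ¬ f =ᵐ[mu0] 0) (hrho : ∫⁻ t in Ioi 0, avgRearr mu0 f t ^ p * φ t ≠ ⊤) (K : ℝ≥0∞)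
    (hK : ∀ t, 0 < t → (intPhi φ (s * t) + ENNReal.ofReal ((s * t) ^ p) * tailP ⊤ p φ (s * t)) /
            (intPhi φ t + ENNReal.ofReal (t ^ p) * tailP ⊤ p φ t) ≤ K) :
    ∫⁻ t in Ioi 0, avgRearr mu0 f (t / s) ^ p * φ t ≤ K * ∫⁻ t in Ioi 0, avgRearr mu0 f t ^ p * φ t := by
  obtain ⟨⟨hm, hpos, hloc⟩, htail, -⟩ := hφ
  have htail := htail rfl
  have hpos : ∀ t, 0 < t → φ t ≠ 0 := fun t ht => (hpos t (by rw [IbSet_top]; exact ht)).1.ne'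
  have hp0 : 0 < p := by linarith
  have hX : ∀ t, 0 < t → ∫⁻ s in Ioo (0 : ℝ) t, decRearr mu0 f s ≠ ⊤ := by
    intro t ht htop
    apply hrho
    rw [eq_top_iff]
    calc (⊤ : ℝ≥0∞) = ∫⁻ r in Ioi t, ⊤ := by simp
      _ ≤ ∫⁻ r in Ioi t, avgRearr mu0 f r ^ p * φ r := by
          apply setLIntegral_mono' measurableSet_Ioi
          intro r hr
          have hr : t < r := hr
          have : ∫⁻ s in Ioo (0 : ℝ) r, decRearr mu0 f s = ⊤ := by
            rw [eq_top_iff, ← htop]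
            exact lintegral_mono_set (Ioo_subset_Ioo_right hr.le)
          rw [avgRearr, this, ENNReal.mul_top (by simp), ENNReal.top_rpow_of_pos hp0,
            ENNReal.top_mul (hpos r (by linarith))]
      _ ≤ _ := lintegral_mono_set (Ioi_subset_Ioi ht.le)
  have hF : ∀ r, 0 < r → avgRearr mu0 f r ≠ ⊤ := by
    intro r hr
    exact ENNReal.mul_ne_top (by simp [hr]) (hX r hr)
  have hint1 : intPhi φ 1 ≠ ⊤ := by
    intro htop
    apply hrho
    rw [eq_top_iff]
    calc (⊤ : ℝ≥0∞) = avgRearr mu0 f 1 ^ p * intPhi φ 1 := by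
            rw [htop, ENNReal.mul_top]
            rw [Ne, ENNReal.rpow_eq_zero_iff_of_pos hp0]
            exact avg_one_ne_zero f hf
      _ = ∫⁻ r in Ioo 0 1, avgRearr mu0 f 1 ^ p * φ r := by rw [lintegral_const_mul _ hm]; rfl
      _ ≤ ∫⁻ r in Ioo 0 1, avgRearr mu0 f r ^ p * φ r := by
          apply setLIntegral_mono' measurableSet_Ioo
          intro r hr
          gcongr
          exact avgRearr_antiOn f hr.1 (by simp) hr.2.le
      _ ≤ _ := lintegral_mono_set Ioo_subset_Ioi_self
  have hintg : ∀ t, intPhi φ t ≠ ⊤ := by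
    intro t
    have h1 : Ioo 0 t ⊆ Ioo 0 1 ∪ Icc 1 t := by
      intro x hx
      rcases lt_or_ge x 1 with h | h
      · left; exact ⟨hx.1, h⟩
      · right; exact ⟨h, hx.2.le⟩
    refine ne_top_of_le_ne_top ?_ ((lintegral_mono_set h1).trans (lintegral_union_le _ _ _))
    exact ENNReal.add_ne_top.2 ⟨hint1, (hloc 1 t one_pos (by simp)).ne⟩
  have htl : ∀ t, 0 < t → tailP ⊤ p φ t ≠ ⊤ := by
    intro t ht
    rw [tailP, tset_top]
    have h1 : Ioi t ⊆ Icc t 1 ∪ Ioi 1 := by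
      intro x hx
      have hx : t < x := hx
      rcases le_or_gt x 1 with h | h
      · left; exact ⟨hx.le, h⟩
      · right; exact h
    refine ne_top_of_le_ne_top ?_ ((lintegral_mono_set h1).trans (lintegral_union_le _ _ _))
    refine ENNReal.add_ne_top.2 ⟨?_, htail.ne⟩
    have h2 : ∫⁻ y in Icc t 1, φ y * ENNReal.ofReal (y ^ (-p)) ≤ ∫⁻ y in Icc t 1, φ y * ENNReal.ofReal (t ^ (-p)) := by
      apply setLIntegral_mono' measurableSet_Icc
      intro y hy
      refine mul_le_mul_right (ENNReal.ofReal_le_ofReal ?_) _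
      exact Real.rpow_le_rpow_of_nonpos ht hy.1 (by linarith)
    refine ne_top_of_le_ne_top ?_ h2
    rw [lintegral_mul_const _ hm]
    exact ENNReal.mul_ne_top (hloc t 1 ht (by simp)).ne (by simp)
  have hip : ∀ t, 0 < t → intPhi φ t ≠ 0 := by
    intro t ht h0
    rw [intPhi, lintegral_eq_zero_iff hm] at h0
    have : ∀ᵐ x ∂(volume.restrict (Ioo (0:ℝ) t)), False := by
      filter_upwards [h0, ae_restrict_mem measurableSet_Ioo] with x hx hx2
      exact hpos x hx2.1 hx
    rw [ae_iff] at this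
    simp [ht] at this
    linarith
  have hD : ∀ t, 0 < t → intPhi φ (s * t) + ENNReal.ofReal ((s * t) ^ p) * tailP ⊤ p φ (s * t) ≤
      K * (intPhi φ t + ENNReal.ofReal (t ^ p) * tailP ⊤ p φ t) := by
    intro t ht
    have := hK t ht
    rwa [ENNReal.div_le_iff] at this
    · simp [hip t ht]
    · exact ENNReal.add_ne_top.2 ⟨hintg t, ENNReal.mul_ne_top (by simp) (htl t ht)⟩
  have e2 := rho_rep p hp φ hm f hX 1 one_pos
  simp only [div_one] at e2
  rw [rho_rep p hp φ hm f hX s hs, e2]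
  have hac : ∀ s, muS p φ s ≪ volume.restrict (Ioi 0) := fun s => withDensity_absolutelyContinuous _ _
  have hnull : ∀ s, muS p φ s (Iic 0) = 0 := by
    intro s
    refine hac s ?_
    rw [Measure.restrict_apply' measurableSet_Ioi, Iic_inter_Ioi]
    simp
  apply antitone_compare _ _ K (hnull s) (hnull 1)
  · intro x
    refine hac s ?_
    exact measure_singleton x
  · intro R hR
    rw [muS_Ioo p hp φ hm s hs R hR, muS_Ioo p hp φ hm 1 one_pos R hR, one_mul]
    exact hD R hR
  · exact ((avgRearr_meas f).pow_const _).mul (decRearr_anti f).measurable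
  · intro a ha b hb hab
    beta_reduce
    exact mul_le_mul' (ENNReal.rpow_le_rpow (avgRearr_antiOn f ha hb hab) (by linarith))
      (decRearr_anti f hab)
  · intro r hr
    exact ENNReal.mul_ne_top (ENNReal.rpow_ne_top_of_nonneg (by linarith) (hF r hr))
      (ne_top_of_le_ne_top (hF r hr) (decRearr_le_avg f r hr))

theorem statement1 (p : ℝ) (hp : 1 < p) (φ : ℝ → ℝ≥0∞)
    (hφ : IsNontrivialWeight ⊤ p φ) :
    ∃ c C : ℝ, 0 < c ∧ 0 < C ∧ ∀ s : ℝ, 0 < s →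
      ENNReal.ofReal c * (⨆ (t : ℝ) (_ : 0 < t),
          ((intPhi φ (s * t) + ENNReal.ofReal (s ^ p * t ^ p) * tailP ⊤ p φ (s * t)) /
            (intPhi φ t + ENNReal.ofReal (t ^ p) * tailP ⊤ p φ t)) ^ (1 / p)) ≤
        (⨆ (f : ℝ → ℝ) (_ : Measurable f) (_ : ∀ x, 0 ≤ f x) (_ : ¬ f =ᵐ[mu0] 0),
          rhoGamma mu0 ⊤ p φ (fun t => f (t / s)) / rhoGamma mu0 ⊤ p φ f) ∧
      (⨆ (f : ℝ → ℝ) (_ : Measurable f) (_ : ∀ x, 0 ≤ f x) (_ : ¬ f =ᵐ[mu0] 0),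
          rhoGamma mu0 ⊤ p φ (fun t => f (t / s)) / rhoGamma mu0 ⊤ p φ f) ≤
        ENNReal.ofReal C * (⨆ (t : ℝ) (_ : 0 < t),
          ((intPhi φ (s * t) + ENNReal.ofReal (s ^ p * t ^ p) * tailP ⊤ p φ (s * t)) /
            (intPhi φ t + ENNReal.ofReal (t ^ p) * tailP ⊤ p φ t)) ^ (1 / p)) := by
  have hp0 : 0 < p := by linarith
  have hm := hφ.1.1
  refine ⟨1, 1, one_pos, one_pos, fun s hs => ?_⟩
  rw [ENNReal.ofReal_one, one_mul]
  have hst : ∀ t : ℝ, 0 < t → s ^ p * t ^ p = (s * t) ^ p := fun t ht => (Real.mul_rpow hs.le ht.le).symm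
  constructor
  · refine iSup₂_le fun t ht => ?_
    have h1 : Measurable ((Ioo 0 t).indicator (fun _ => (1:ℝ))) := measurable_const.indicator measurableSet_Ioo
    have h2 : ∀ x, 0 ≤ (Ioo 0 t).indicator (fun _ => (1:ℝ)) x := fun x => indicator_nonneg (fun _ _ => zero_le_one) x
    have h3 : ¬ ((Ioo 0 t).indicator (fun _ => (1:ℝ))) =ᵐ[mu0] 0 := by
      intro h
      have h4 : mu0 (Ioo 0 t) = 0 := by
        refine measure_mono_null ?_ (ae_iff.1 h)
        intro x hx
        simp only [mem_ofPred_eq, indicator_of_mem hx]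
        simp
      rw [mu0, Measure.restrict_apply' measurableSet_Ioi, inter_eq_left.2 Ioo_subset_Ioi_self,
        Real.volume_Ioo, ENNReal.ofReal_eq_zero] at h4
      linarith
    refine le_trans (le_of_eq ?_) (le_iSup₂_of_le _ h1 (le_iSup₂_of_le h2 h3 le_rfl))
    have h5 : (fun x => (Ioo 0 t).indicator (fun _ => (1:ℝ)) (x / s)) = (Ioo 0 (s * t)).indicator (fun _ => (1:ℝ)) := by
      ext x
      simp only [indicator, mem_Ioo, div_lt_iff₀ hs, mul_comm t s]
      simp [hs]
    rw [h5, rho_ind p hp φ hm t ht, rho_ind p hp φ hm (s * t) (by positivity), hst t ht,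
      ENNReal.div_rpow_of_nonneg _ _ (by positivity)]
  · refine iSup₂_le fun f _ => iSup₂_le fun _ hf => ?_
    set A := (⨆ (t : ℝ) (_ : 0 < t),
          ((intPhi φ (s * t) + ENNReal.ofReal (s ^ p * t ^ p) * tailP ⊤ p φ (s * t)) /
            (intPhi φ t + ENNReal.ofReal (t ^ p) * tailP ⊤ p φ t)) ^ (1 / p)) with hA
    by_cases hrho : ∫⁻ t in Ioi 0, avgRearr mu0 f t ^ p * φ t = ⊤
    · have : rhoGamma mu0 ⊤ p φ f = ⊤ := by
        rw [rhoGamma, IbSet_top, hrho, ENNReal.top_rpow_of_pos (by positivity)]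
      rw [this, ENNReal.div_top]
      exact zero_le
    · apply ENNReal.div_le_of_le_mul
      have key := upper_aux p hp φ hφ s hs f hf hrho (A ^ p) (by
        intro t ht
        have : _ ≤ A := le_iSup₂_of_le (f := fun (t : ℝ) (_ : 0 < t) =>
          ((intPhi φ (s * t) + ENNReal.ofReal (s ^ p * t ^ p) * tailP ⊤ p φ (s * t)) /
            (intPhi φ t + ENNReal.ofReal (t ^ p) * tailP ⊤ p φ t)) ^ (1 / p)) t ht le_rfl
        rw [hst t ht, one_div, ENNReal.rpow_inv_le_iff hp0] at this
        exact this)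
      have e : rhoGamma mu0 ⊤ p φ (fun t => f (t / s)) =
          (∫⁻ t in Ioi 0, avgRearr mu0 f (t / s) ^ p * φ t) ^ (1 / p) := by
        rw [rhoGamma, IbSet_top]
        simp_rw [avgRearr_dilate s hs]
      rw [e, rhoGamma, IbSet_top]
      refine (ENNReal.rpow_le_rpow key (by positivity)).trans_eq ?_
      rw [ENNReal.mul_rpow_of_nonneg _ _ (by positivity), one_div, ENNReal.rpow_rpow_inv hp0.ne']

end
end

section
/- Fix 1 < p < ∞ and b ∈ (0, ∞], let φ be a non-trivial weight on I_b = (0, b), and set ψ := (Pφ)(Q_pφ)/[(PQ_p)(φ)]^{p'+1}. Then there exists C > 0, independent of f and g, such that for every nonnegative decreasing f and every g ∈ M₊(I_b): ∫₀ᵇ f(t) g(t) [(Pφ)(t)/((PQ_p)(φ))(t)]^{(1/p')+1} dt ≤ C (∫₀ᵇ f(t)^p φ(t) dt)^{1/p} · [(∫₀ᵇ (Pg)(t)^{p'} ψ(t) dt)^{1/p'} + (∫₀ᵇ g)/(∫₀ᵇ φ)^{1/p}]. -/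
open MeasureTheory Set ENNReal Filter

noncomputable section

lemma rpow_anti {x y : ℝ≥0∞} {r : ℝ} (hr : -r ≤ 0) (hxy : x ≤ y) : y ^ (-r) ≤ x ^ (-r) := by
  rw [ENNReal.rpow_neg, ENNReal.rpow_neg, ENNReal.inv_le_inv]
  exact ENNReal.rpow_le_rpow hxy (by linarith)

lemma measJ (b : ℝ≥0∞) (t : ℝ) : MeasurableSet {s : ℝ | t < s ∧ ENNReal.ofReal s < b} :=
  measurableSet_Ioi.inter (measurableSet_lt ENNReal.measurable_ofReal measurable_const)

lemma tonelliJ (b : ℝ≥0∞) (g X : ℝ → ℝ≥0∞) (hg : Measurable g) (hX : Measurable X) :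
    ∫⁻ t in IbSet b, g t * ∫⁻ s in {s : ℝ | t < s ∧ ENNReal.ofReal s < b}, X s =
      ∫⁻ s in IbSet b, X s * ∫⁻ t in Ioo 0 s, g t := by
  have hI : MeasurableSet (IbSet b) := measJ b 0
  set S : Set (ℝ × ℝ) := {z | 0 < z.1 ∧ z.1 < z.2 ∧ ENNReal.ofReal z.2 < b} with hS
  have hSm : MeasurableSet S := by
    refine (measurableSet_lt measurable_const measurable_fst).inter
      ((measurableSet_lt measurable_fst measurable_snd).inter ?_)
    exact measurableSet_lt (ENNReal.measurable_ofReal.comp measurable_snd) measurable_const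
  set K : ℝ → ℝ → ℝ≥0∞ := fun t s => S.indicator (fun z => g z.1 * X z.2) (t, s) with hK
  have hKm : Measurable (Function.uncurry K) := by
    exact ((hg.comp measurable_fst).mul (hX.comp measurable_snd)).indicator hSm
  have e1 : ∫⁻ t in IbSet b, g t * ∫⁻ s in {s : ℝ | t < s ∧ ENNReal.ofReal s < b}, X s
      = ∫⁻ t, ∫⁻ s, K t s := by
    rw [← lintegral_indicator hI]
    refine lintegral_congr fun t => ?_
    by_cases ht : t ∈ IbSet b
    · rw [indicator_of_mem ht, ← lintegral_indicator (measJ b t),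
        ← lintegral_const_mul _ (hX.indicator (measJ b t))]
      refine lintegral_congr fun s => ?_
      by_cases hs : t < s ∧ ENNReal.ofReal s < b
      · have : (t, s) ∈ S := ⟨ht.1, hs⟩
        simp only [hK]
        rw [indicator_of_mem this, indicator_of_mem (show s ∈ {s : ℝ | t < s ∧ ENNReal.ofReal s < b} from hs)]
      · have : (t, s) ∉ S := fun h => hs h.2
        simp only [hK]
        rw [indicator_of_notMem this, indicator_of_notMem (show s ∉ {s : ℝ | t < s ∧ ENNReal.ofReal s < b} from hs), mul_zero]
    · rw [indicator_of_notMem ht]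
      symm
      rw [← lintegral_zero (μ := (volume : Measure ℝ))]
      refine lintegral_congr fun s => ?_
      have : (t, s) ∉ S := fun h => ht ⟨h.1, lt_of_le_of_lt (ENNReal.ofReal_le_ofReal h.2.1.le) h.2.2⟩
      simp only [hK]
      rw [indicator_of_notMem this]
  have e2 : ∫⁻ s in IbSet b, X s * ∫⁻ t in Ioo 0 s, g t = ∫⁻ s, ∫⁻ t, K t s := by
    rw [← lintegral_indicator hI]
    refine lintegral_congr fun s => ?_
    by_cases hs : s ∈ IbSet b
    · rw [indicator_of_mem hs, ← lintegral_indicator measurableSet_Ioo,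
        ← lintegral_const_mul _ (hg.indicator measurableSet_Ioo)]
      refine lintegral_congr fun t => ?_
      by_cases ht : t ∈ Ioo 0 s
      · have : (t, s) ∈ S := ⟨ht.1, ht.2, hs.2⟩
        simp only [hK]
        rw [indicator_of_mem this, indicator_of_mem ht, mul_comm]
      · have : (t, s) ∉ S := fun h => ht ⟨h.1, h.2.1⟩
        simp only [hK]
        rw [indicator_of_notMem this, indicator_of_notMem ht, mul_zero]
    · rw [indicator_of_notMem hs]
      symm
      rw [← lintegral_zero (μ := (volume : Measure ℝ))]
      refine lintegral_congr fun t => ?_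
      have : (t, s) ∉ S := fun h => hs ⟨h.1.trans h.2.1, h.2.2⟩
      simp only [hK]
      rw [indicator_of_notMem this]
  rw [e1, e2, lintegral_lintegral_swap hKm.aemeasurable]

lemma intPhi_mono (h : ℝ → ℝ≥0∞) : Monotone (intPhi h) := fun _ _ hab =>
  lintegral_mono_set (Ioo_subset_Ioo_right hab)

lemma intPhi_meas (h : ℝ → ℝ≥0∞) : Measurable (intPhi h) := (intPhi_mono h).measurable

lemma tail_anti (b : ℝ≥0∞) (h : ℝ → ℝ≥0∞) :
    Antitone fun t : ℝ => ∫⁻ s in {s : ℝ | t < s ∧ ENNReal.ofReal s < b}, h s := fun _ _ hab =>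
  lintegral_mono_set fun _ hs => ⟨lt_of_le_of_lt hab hs.1, hs.2⟩

lemma intPhi_split (h : ℝ → ℝ≥0∞) {u t : ℝ} : intPhi h t ≤ intPhi h u + ∫⁻ s in Ioo u t, h s := by
  have : Ioo 0 t ⊆ Ioo 0 u ∪ Ico u t := fun s hs => by
    rcases lt_or_ge s u with h | h
    · exact Or.inl ⟨hs.1, h⟩
    · exact Or.inr ⟨h, hs.2⟩
  rw [setLIntegral_congr (Ioo_ae_eq_Ico (a := u) (b := t) (μ := volume))]
  exact (lintegral_mono_set this).trans (lintegral_union_le _ _ _)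

/-- lower sets -/
lemma lint_le_of_forall (h : ℝ → ℝ≥0∞) (L : Set ℝ) (hL : L ⊆ Ioi 0)
    (y : ℝ≥0∞) (hy : ∀ c ∈ L, intPhi h c ≤ y) : ∫⁻ s in L, h s ≤ y := by
  obtain ⟨T, hTL, hTc, hTe⟩ := TopologicalSpace.isOpen_biUnion_countable L (fun c => Ioo (0 : ℝ) c)
    (fun _ _ => isOpen_Ioo)
  have hsub : L ⊆ (⋃ c ∈ T, Ioo (0 : ℝ) c) ∪ (L \ ⋃ c ∈ L, Ioo (0 : ℝ) c) := by
    rw [hTe]; intro x hx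
    by_cases hx2 : x ∈ ⋃ c ∈ L, Ioo (0 : ℝ) c
    · exact Or.inl hx2
    · exact Or.inr ⟨hx, hx2⟩
  have hnull : volume (L \ ⋃ c ∈ L, Ioo (0 : ℝ) c) = 0 := by
    apply Set.Subsingleton.measure_zero
    intro x hx z hz
    simp only [Set.mem_sdiff, mem_iUnion, mem_Ioo, not_exists, not_and, not_lt] at hx hz
    exact le_antisymm (hz.2 x hx.1 (hL hz.1)) (hx.2 z hz.1 (hL hx.1))
  refine (lintegral_mono_set hsub).trans ((lintegral_union_le _ _ _).trans ?_)
  rw [setLIntegral_measure_zero _ _ hnull, add_zero]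
  have := hTc.to_subtype
  rw [biUnion_eq_iUnion, setLIntegral_iUnion_of_directed]
  · exact iSup_le fun i => hy i (hTL i.2)
  · intro i j
    rcases le_total (i : ℝ) j with hij | hij
    · exact ⟨j, Ioo_subset_Ioo_right hij, le_rfl⟩
    · exact ⟨i, le_rfl, Ioo_subset_Ioo_right hij⟩

lemma ivt_intPhi (h : ℝ → ℝ≥0∞) (hm : Measurable h) {a c : ℝ} (ha : 0 ≤ a) (hac : a ≤ c)
    (hfin : intPhi h c ≠ ⊤) (y : ℝ≥0∞) (h1 : intPhi h a ≤ y) (h2 : y ≤ intPhi h c) :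
    ∃ u, a ≤ u ∧ u ≤ c ∧ intPhi h u = y := by
  have hint : IntegrableOn (fun s => (h s).toReal) (Ioo 0 c) :=
    integrable_toReal_of_lintegral_ne_top hm.aemeasurable hfin
  have hint2 : IntegrableOn (fun s => (h s).toReal) (Icc 0 c) := by
    rwa [integrableOn_Icc_iff_integrableOn_Ioo]
  have hcont := intervalIntegral.continuousOn_primitive hint2
  have hae : ∀ᵐ s ∂(volume.restrict (Ioo 0 c)), h s < ⊤ := ae_lt_top hm hfin
  have heq : ∀ u ∈ Icc a c, ∫ s in Ioc 0 u, (h s).toReal = (intPhi h u).toReal := by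
    intro u hu
    rw [integral_Ioc_eq_integral_Ioo, integral_toReal hm.aemeasurable
      (ae_restrict_of_ae_restrict_of_subset (Ioo_subset_Ioo_right hu.2) hae)]
    rfl
  have hfin' : ∀ u ∈ Icc a c, intPhi h u ≠ ⊤ := fun u hu =>
    ne_top_of_le_ne_top hfin (intPhi_mono h hu.2)
  have hy : y ≠ ⊤ := ne_top_of_le_ne_top hfin h2
  have := intermediate_value_Icc hac (hcont.mono (Icc_subset_Icc_left ha))
  have hmem : y.toReal ∈ Icc (∫ s in Ioc 0 a, (h s).toReal) (∫ s in Ioc 0 c, (h s).toReal) := by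
    rw [heq a ⟨le_rfl, hac⟩, heq c ⟨hac, le_rfl⟩]
    exact ⟨ENNReal.toReal_mono hy h1, ENNReal.toReal_mono hfin h2⟩
  obtain ⟨u, hu, hu2⟩ := this hmem
  refine ⟨u, hu.1, hu.2, ?_⟩
  simp only [heq u hu] at hu2
  exact (ENNReal.toReal_eq_toReal_iff' (hfin' u hu) hy).1 hu2

lemma lint_pow (p : ℝ) (hp : 1 < p) {u : ℝ} (hu : 0 < u) :
    ∫⁻ s in Ioo 0 u, ENNReal.ofReal (p * s ^ (p - 1)) = ENNReal.ofReal (u ^ p) := by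
  have hI : IntervalIntegrable (fun s : ℝ => p * s ^ (p - 1)) volume 0 u :=
    (intervalIntegral.intervalIntegrable_rpow' (by linarith)).const_mul p
  rw [intervalIntegrable_iff_integrableOn_Ioo_of_le hu.le] at hI
  rw [← ofReal_integral_eq_lintegral_ofReal hI]
  · rw [← integral_Ioc_eq_integral_Ioo, ← intervalIntegral.integral_of_le hu.le,
      intervalIntegral.integral_const_mul, integral_rpow (Or.inl (by linarith))]
    congr 1
    have : p ≠ 0 := by linarith
    rw [sub_add_cancel, Real.zero_rpow this]
    field_simp
    ring
  · refine (ae_restrict_iff' measurableSet_Ioo).2 (Eventually.of_forall fun s hs => ?_)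
    have := hs.1
    show (0 : ℝ) ≤ p * s ^ (p - 1)
    positivity

lemma DPhi_eq (b : ℝ≥0∞) (p : ℝ) (hp : 1 < p) (φ : ℝ → ℝ≥0∞) (hφ : Measurable φ) {t : ℝ}
    (ht : t ∈ IbSet b) : DPhi b p φ t = intPhi (Qp b p φ) t := by
  have ht0 : 0 < t := ht.1
  have hw : Measurable fun s : ℝ => φ s * ENNReal.ofReal (s ^ (-p)) := by fun_prop
  have hpm : Measurable fun s : ℝ => ENNReal.ofReal (p * s ^ (p - 1)) := by fun_prop
  have hset : IbSet (ENNReal.ofReal t) = Ioo 0 t := by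
    ext s
    simp only [IbSet, Set.mem_ofPred_eq, mem_Ioo, ENNReal.ofReal_lt_ofReal_iff ht0]
  have hsplit : ∀ s ∈ Ioo 0 t, Qp b p φ s = ENNReal.ofReal (p * s ^ (p - 1)) *
      (∫⁻ u in {u : ℝ | s < u ∧ ENNReal.ofReal u < ENNReal.ofReal t},
        φ u * ENNReal.ofReal (u ^ (-p))) + ENNReal.ofReal (p * s ^ (p - 1)) * tailP b p φ t := by
    intro s hs
    rw [← mul_add, Qp]
    congr 1
    rw [← lintegral_inter_add_sdiff _ _ (measurableSet_Iic (a := t))]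
    congr 1
    · have e1 : {u : ℝ | s < u ∧ ENNReal.ofReal u < b} ∩ Iic t = Ioc s t := by
        ext u
        simp only [mem_inter_iff, Set.mem_ofPred_eq, mem_Iic, mem_Ioc]
        exact ⟨fun h => ⟨h.1.1, h.2⟩, fun h => ⟨⟨h.1, lt_of_le_of_lt
          (ENNReal.ofReal_le_ofReal h.2) ht.2⟩, h.2⟩⟩
      have e2 : {u : ℝ | s < u ∧ ENNReal.ofReal u < ENNReal.ofReal t} = Ioo s t := by
        ext u
        simp only [Set.mem_ofPred_eq, mem_Ioo, ENNReal.ofReal_lt_ofReal_iff ht0]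
      rw [e1, e2]
      exact setLIntegral_congr Ioo_ae_eq_Ioc.symm
    · rw [tailP]
      congr 2
      ext u
      simp only [Set.mem_sdiff, Set.mem_ofPred_eq, mem_Iic, not_le]
      exact ⟨fun h => ⟨h.2, h.1.2⟩, fun h => ⟨⟨hs.2.trans h.1, h.2⟩, h.1⟩⟩
  rw [intPhi, setLIntegral_congr_fun measurableSet_Ioo hsplit,
    lintegral_add_right _ (hpm.mul_const _), lintegral_mul_const _ hpm, lint_pow p hp ht0, DPhi]
  congr 1
  rw [← hset, tonelliJ _ _ _ hpm hw, hset, intPhi]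
  refine setLIntegral_congr_fun measurableSet_Ioo fun s hs => ?_
  rw [lint_pow p hp hs.1, mul_assoc, ← ENNReal.ofReal_mul (Real.rpow_nonneg hs.1.le _),
    ← Real.rpow_add hs.1]
  simp

lemma L1 (h : ℝ → ℝ≥0∞) (hm : Measurable h) {t : ℝ} (ht : 0 < t) (hfin : intPhi h t ≠ ⊤)
    {q : ℝ} (hq : 0 ≤ q) :
    intPhi h t ^ (q + 1) ≤ 2 ^ (q + 1) * ∫⁻ s in Ioo 0 t, intPhi h s ^ q * h s := by
  obtain ⟨u, hu0, hut, hu⟩ := ivt_intPhi h hm le_rfl ht.le hfin (intPhi h t / 2)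
    (by simp [intPhi]) ENNReal.half_le_self
  have h1 : intPhi h t / 2 ≤ ∫⁻ s in Ioo u t, h s := by
    have := intPhi_split h (u := u) (t := t)
    rw [hu] at this
    nth_rewrite 1 [← ENNReal.add_halves (intPhi h t)] at this
    exact (ENNReal.add_le_add_iff_left (ENNReal.div_ne_top hfin (by simp))).1 this
  have h2 : (intPhi h t / 2) ^ q * (intPhi h t / 2) ≤ ∫⁻ s in Ioo 0 t, intPhi h s ^ q * h s := by
    calc _ ≤ (intPhi h t / 2) ^ q * ∫⁻ s in Ioo u t, h s := by gcongr
      _ = ∫⁻ s in Ioo u t, (intPhi h t / 2) ^ q * h s := (lintegral_const_mul _ hm).symm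
      _ ≤ ∫⁻ s in Ioo u t, intPhi h s ^ q * h s := by
          refine setLIntegral_mono' measurableSet_Ioo fun s hs => ?_
          rw [← hu]
          gcongr
          exact intPhi_mono h hs.1.le
      _ ≤ _ := lintegral_mono_set (Ioo_subset_Ioo_left hu0)
  calc intPhi h t ^ (q + 1) = 2 ^ (q + 1) * (intPhi h t / 2) ^ (q + 1) := by
        rw [← ENNReal.mul_rpow_of_nonneg _ _ (by linarith), ENNReal.mul_div_cancel (by simp) (by simp)]
    _ = 2 ^ (q + 1) * ((intPhi h t / 2) ^ q * (intPhi h t / 2)) := by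
        rw [ENNReal.rpow_add_of_nonneg (x := intPhi h t / 2) _ _ hq zero_le_one, ENNReal.rpow_one]
    _ ≤ _ := by gcongr

lemma L2 (p : ℝ) (hp : 1 < p) : ∃ K : ℝ≥0∞, K ≠ ⊤ ∧ ∀ (b : ℝ≥0∞) (h : ℝ → ℝ≥0∞),
    Measurable h → (∀ t ∈ IbSet b, intPhi h t ≠ 0 ∧ intPhi h t ≠ ⊤) → ∀ x ∈ IbSet b,
    ∫⁻ s in {s : ℝ | x < s ∧ ENNReal.ofReal s < b}, intPhi h s ^ (-p) * h s ≤
      K * intPhi h x ^ (1 - p) := by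
  refine ⟨∑' k : ℕ, 2 * ((2 : ℝ≥0∞) ^ (1 - p)) ^ k, ?_, ?_⟩
  · rw [ENNReal.tsum_mul_left, ENNReal.tsum_geometric]
    refine ENNReal.mul_ne_top (by simp) (ENNReal.inv_ne_top.2 ?_)
    have : (2 : ℝ≥0∞) ^ (1 - p) < 1 :=
      ENNReal.rpow_lt_one_of_one_lt_of_neg (by norm_num) (by linarith)
    exact (tsub_pos_of_lt this).ne'
  intro b h hm hH x hx
  obtain ⟨hx0, hxt⟩ := hH x hx
  set H := intPhi h with hHdef
  have hI : MeasurableSet (IbSet b) := measJ b 0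
  have hHm : Measurable H := intPhi_meas h
  set L : ℕ → Set ℝ := fun k => {s | s ∈ IbSet b ∧ H s < 2 ^ (k + 1) * H x} with hL
  set S : ℕ → Set ℝ := fun k => L k ∩ {s | 2 ^ k * H x ≤ H s} with hS
  have hSm : ∀ k, MeasurableSet (S k) := fun k =>
    (hI.inter (measurableSet_lt hHm measurable_const)).inter (measurableSet_le measurable_const hHm)
  have hsub : {s : ℝ | x < s ∧ ENNReal.ofReal s < b} ⊆ ⋃ k, S k := by
    intro s hs
    have hsI : s ∈ IbSet b := ⟨hx.1.trans hs.1, hs.2⟩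
    have hle : H x ≤ H s := intPhi_mono h hs.1.le
    have hst := (hH s hsI).2
    have hxr : 0 < (H x).toReal := ENNReal.toReal_pos hx0 hxt
    obtain ⟨n, hn1, hn2⟩ := exists_nat_pow_near (x := (H s).toReal / (H x).toReal) (y := (2 : ℝ))
      (by rw [le_div_iff₀ hxr, one_mul]; exact ENNReal.toReal_mono hst hle) (by norm_num)
    rw [le_div_iff₀ hxr] at hn1
    rw [div_lt_iff₀ hxr] at hn2
    have conv : ∀ m : ℕ, (2 : ℝ) ^ m * (H x).toReal = ((2 : ℝ≥0∞) ^ m * H x).toReal := by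
      intro m; simp [ENNReal.toReal_mul, ENNReal.toReal_pow]
    have hft : ∀ m : ℕ, (2 : ℝ≥0∞) ^ m * H x ≠ ⊤ := fun m =>
      ENNReal.mul_ne_top (by simp) hxt
    rw [conv] at hn1 hn2
    refine mem_iUnion.2 ⟨n, ⟨hsI, ?_⟩, ?_⟩
    · exact (ENNReal.toReal_lt_toReal hst (hft _)).1 hn2
    · exact (ENNReal.toReal_le_toReal (hft _) hst).1 hn1
  refine (lintegral_mono_set hsub).trans ((lintegral_iUnion_le _ _).trans ?_)
  rw [← ENNReal.tsum_mul_right]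
  refine ENNReal.tsum_le_tsum fun k => ?_
  have hk0 : (2 : ℝ≥0∞) ^ k ≠ 0 := by simp
  have hkt : (2 : ℝ≥0∞) ^ k ≠ ⊤ := by simp
  calc ∫⁻ s in S k, H s ^ (-p) * h s ≤ ∫⁻ s in S k, (2 ^ k * H x) ^ (-p) * h s := by
        refine setLIntegral_mono' (hSm k) fun s hs => ?_
        gcongr ?_ * _
        exact rpow_anti (by linarith) hs.2
    _ = (2 ^ k * H x) ^ (-p) * ∫⁻ s in S k, h s := lintegral_const_mul _ hm
    _ ≤ (2 ^ k * H x) ^ (-p) * (2 ^ (k + 1) * H x) := by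
        gcongr
        refine (lintegral_mono_set inter_subset_left).trans ?_
        exact lint_le_of_forall h (L k) (fun s hs => hs.1.1) _ fun c hc => hc.2.le
    _ = 2 * (2 ^ k * H x) ^ (1 - p) := by
        rw [sub_eq_add_neg, ENNReal.rpow_add _ _ (mul_ne_zero hk0 hx0) (ENNReal.mul_ne_top hkt hxt),
          ENNReal.rpow_one]
        ring
    _ = 2 * ((2 : ℝ≥0∞) ^ (1 - p)) ^ k * H x ^ (1 - p) := by
        rw [ENNReal.mul_rpow_of_ne_top hkt hxt, ← ENNReal.rpow_natCast, ← ENNReal.rpow_mul,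
          ← ENNReal.rpow_natCast ((2 : ℝ≥0∞) ^ (1 - p)), ← ENNReal.rpow_mul, mul_comm (k : ℝ)]
        ring

lemma core0 (p : ℝ) (hp : 1 < p) (φ f : ℝ → ℝ≥0∞) (hφ : Measurable φ) (hf : Antitone f)
    {t : ℝ} (ht : 0 < t) (hfin : intPhi φ t ≠ ⊤) :
    f t * intPhi φ t ≤
      2 * (intPhi (fun s => f s ^ p * intPhi φ s ^ (p - 1) * φ s) t) ^ (1 / p) := by
  have hp0 : 0 < p := by linarith
  have h1 := L1 φ hφ ht hfin (q := p - 1) (by linarith)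
  rw [sub_add_cancel] at h1
  have hm : Measurable fun s => intPhi φ s ^ (p - 1) * φ s :=
    ((intPhi_meas φ).pow_const _).mul hφ
  have h2 : (f t * intPhi φ t) ^ p ≤
      2 ^ p * intPhi (fun s => f s ^ p * intPhi φ s ^ (p - 1) * φ s) t := by
    rw [ENNReal.mul_rpow_of_nonneg _ _ hp0.le]
    calc f t ^ p * intPhi φ t ^ p
        ≤ f t ^ p * (2 ^ p * ∫⁻ s in Ioo 0 t, intPhi φ s ^ (p - 1) * φ s) := by gcongr
      _ = 2 ^ p * ∫⁻ s in Ioo 0 t, f t ^ p * (intPhi φ s ^ (p - 1) * φ s) := by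
          rw [lintegral_const_mul _ hm]; ring
      _ ≤ _ := by
          rw [intPhi]
          refine mul_le_mul_right (setLIntegral_mono' measurableSet_Ioo fun s hs => ?_) _
          rw [mul_assoc]
          gcongr
          exact hf hs.2.le
  have h3 := ENNReal.rpow_le_rpow h2 (z := 1 / p) (by positivity)
  rw [← ENNReal.rpow_mul, mul_one_div_cancel hp0.ne', ENNReal.rpow_one,
    ENNReal.mul_rpow_of_nonneg _ _ (by positivity), ← ENNReal.rpow_mul,
    mul_one_div_cancel hp0.ne', ENNReal.rpow_one] at h3
  exact h3

lemma core1 (p q : ℝ) (hpq : p.HolderConjugate q) (b : ℝ≥0∞) (φ d f : ℝ → ℝ≥0∞)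
    (hφ : Measurable φ) (hd : Measurable d) (hf : Antitone f)
    (hΦ0 : ∀ t ∈ IbSet b, intPhi φ t ≠ 0) (hΦH : ∀ t ∈ IbSet b, intPhi φ t ≤ intPhi d t)
    (hH : ∀ t ∈ IbSet b, intPhi d t ≠ ⊤) {t : ℝ} (ht : t ∈ IbSet b) :
    f t * (intPhi φ t / intPhi d t) ^ (1 / q + 1) ≤
      2 ^ (1 / q + 3) * (∫⁻ s in {s : ℝ | t < s ∧ ENNReal.ofReal s < b},
        (intPhi (fun s => f s ^ p * intPhi φ s ^ (p - 1) * φ s) s) ^ (1 / p) *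
          intPhi φ s ^ (1 / q) * intPhi d s ^ (-(1 / q + 2)) * d s) +
      2 ^ (1 / q + 1) * ((∫⁻ s in IbSet b, f s ^ p * φ s) ^ (1 / p) *
        (∫⁻ s in IbSet b, φ s) ^ (-(1 / p))) := by
  have hp := hpq.lt
  have hp0 : 0 < p := hpq.pos
  have hq0 : 0 < q := hpq.symm.pos
  have hsum : 1 / p + 1 / q = 1 := by simpa using hpq.inv_add_inv_eq_one
  have hc0 : 0 < 1 / q := by positivity
  have ha0 : 0 < 1 / p := by positivity
  set B := intPhi (fun s => f s ^ p * intPhi φ s ^ (p - 1) * φ s) with hB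
  set Φ := intPhi φ with hΦdef
  set H := intPhi d with hHdef
  set Φb := ∫⁻ s in IbSet b, φ s with hΦb
  have hHt := hH t ht
  have hΦt0 := hΦ0 t ht
  have hΦtH := hΦH t ht
  have hΦtt : Φ t ≠ ⊤ := ne_top_of_le_ne_top hHt hΦtH
  have hHt0 : H t ≠ 0 := fun h => hΦt0 (le_antisymm (h ▸ hΦtH) bot_le)
  have hmB : Monotone B := intPhi_mono _
  have hmΦ : Monotone Φ := intPhi_mono _
  have hmH : Monotone H := intPhi_mono _
  have hsubI : ∀ {c : ℝ}, c ∈ IbSet b → Ioo 0 c ⊆ IbSet b := fun hc s hs =>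
    ⟨hs.1, lt_of_le_of_lt (ENNReal.ofReal_le_ofReal hs.2.le) hc.2⟩
  by_cases hcase : ∃ c ∈ IbSet b, 2 * H t < H c
  · refine le_add_right ?_
    obtain ⟨c, hc, hHc⟩ := hcase
    have htc : t ≤ c := by
      by_contra hlt
      have h1 : H c ≤ H t := hmH (not_le.1 hlt).le
      have h2 : H t ≤ 2 * H t := by rw [two_mul]; exact le_self_add
      exact absurd hHc (not_lt.2 (h1.trans h2))
    obtain ⟨u, htu, huc, hu⟩ := ivt_intPhi d hd ht.1.le htc (hH c hc) (2 * H t)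
      (by rw [two_mul]; exact le_self_add) hHc.le
    have h1 : H t ≤ ∫⁻ s in Ioo t u, d s := by
      have := intPhi_split d (u := t) (t := u)
      rw [hu, two_mul] at this
      exact (ENNReal.add_le_add_iff_left hHt).1 this
    set M := B t ^ (1 / p) * Φ t ^ (1 / q) * (2 * H t) ^ (-(1 / q + 2)) with hM
    have h2 : M * H t ≤ ∫⁻ s in {s : ℝ | t < s ∧ ENNReal.ofReal s < b},
        B s ^ (1 / p) * Φ s ^ (1 / q) * H s ^ (-(1 / q + 2)) * d s := by
      calc M * H t ≤ M * ∫⁻ s in Ioo t u, d s := by gcongr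
        _ = ∫⁻ s in Ioo t u, M * d s := (lintegral_const_mul _ hd).symm
        _ ≤ ∫⁻ s in Ioo t u, B s ^ (1 / p) * Φ s ^ (1 / q) * H s ^ (-(1 / q + 2)) * d s := by
            refine setLIntegral_mono' measurableSet_Ioo fun s hs => ?_
            rw [hM]
            have i1 := hmB hs.1.le
            have i2 := hmΦ hs.1.le
            have i3 : (2 * H t) ^ (-(1 / q + 2)) ≤ H s ^ (-(1 / q + 2)) :=
              rpow_anti (by linarith) (by rw [← hu]; exact hmH hs.2.le)
            gcongr
        _ ≤ _ := by
            refine lintegral_mono_set fun s hs => ?_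
            exact ⟨hs.1, lt_of_le_of_lt (ENNReal.ofReal_le_ofReal (hs.2.le.trans huc)) hc.2⟩
    refine le_trans ?_ (mul_le_mul_right h2 _)
    have e1 : f t * (Φ t / H t) ^ (1 / q + 1) = (f t * Φ t) * (Φ t ^ (1 / q) * H t ^ (-(1 / q + 1))) := by
      rw [ENNReal.div_rpow_of_nonneg _ _ (by positivity), div_eq_mul_inv, ← ENNReal.rpow_neg,
        ENNReal.rpow_add_of_nonneg (x := Φ t) _ _ hc0.le zero_le_one, ENNReal.rpow_one]
      ring
    have e2 : 2 ^ (1 / q + 3) * (M * H t) =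
        (2 * B t ^ (1 / p)) * (Φ t ^ (1 / q) * H t ^ (-(1 / q + 1))) := by
      rw [hM, ENNReal.mul_rpow_of_ne_top (by simp) hHt]
      have e3 : (2 : ℝ≥0∞) ^ (1 / q + 3) * 2 ^ (-(1 / q + 2)) = 2 := by
        rw [← ENNReal.rpow_add _ _ (by simp) (by simp)]
        ring_nf
        simp
      have e4 : H t ^ (-(1 / q + 2)) * H t = H t ^ (-(1 / q + 1)) := by
        nth_rewrite 2 [← ENNReal.rpow_one (H t)]
        rw [← ENNReal.rpow_add _ _ hHt0 hHt]
        ring_nf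
      calc _ = (2 ^ (1 / q + 3) * 2 ^ (-(1 / q + 2))) * B t ^ (1 / p) * (Φ t ^ (1 / q) *
            (H t ^ (-(1 / q + 2)) * H t)) := by ring
        _ = _ := by rw [e3, e4]
    rw [e1, e2]
    exact mul_le_mul' (core0 p hp φ f hφ hf ht.1 hΦtt) le_rfl
  · refine le_add_left ?_
    push Not at hcase
    have hb2 : Φb ≤ 2 * H t := lint_le_of_forall φ (IbSet b) (fun s hs => hs.1) _
      fun c hc => (hΦH c hc).trans (hcase c hc)
    have hΦle : Φ t ≤ Φb := lintegral_mono_set (hsubI ht)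
    have hb0 : Φb ≠ 0 := fun h => hΦt0 (le_antisymm (h ▸ hΦle) bot_le)
    have hbt : Φb ≠ ⊤ := ne_top_of_le_ne_top (ENNReal.mul_ne_top (by simp) hHt) hb2
    have i1 : Φ t / H t ≤ 2 * (Φ t * Φb⁻¹) := by
      have : (H t)⁻¹ ≤ 2 * Φb⁻¹ := by
        have h3 : Φb / 2 ≤ H t := ENNReal.div_le_of_le_mul' hb2
        have := ENNReal.inv_le_inv.2 h3
        rwa [ENNReal.inv_div (by simp) (by simp), div_eq_mul_inv] at this
      calc Φ t / H t = Φ t * (H t)⁻¹ := rfl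
        _ ≤ Φ t * (2 * Φb⁻¹) := by gcongr
        _ = _ := by ring
    have i2 : f t * Φ t ^ (1 / p) ≤ (∫⁻ s in IbSet b, f s ^ p * φ s) ^ (1 / p) := by
      have : f t ^ p * Φ t ≤ ∫⁻ s in IbSet b, f s ^ p * φ s := by
        calc f t ^ p * Φ t = ∫⁻ s in Ioo 0 t, f t ^ p * φ s := (lintegral_const_mul _ hφ).symm
          _ ≤ ∫⁻ s in Ioo 0 t, f s ^ p * φ s := by
              refine setLIntegral_mono' measurableSet_Ioo fun s hs => ?_
              gcongr
              exact hf hs.2.le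
          _ ≤ _ := lintegral_mono_set (hsubI ht)
      have h3 := ENNReal.rpow_le_rpow this (z := 1 / p) ha0.le
      rwa [ENNReal.mul_rpow_of_nonneg _ _ ha0.le, ← ENNReal.rpow_mul,
        mul_one_div_cancel hp0.ne', ENNReal.rpow_one] at h3
    have e1 : Φ t ^ (1 / q + 1) = Φ t ^ (1 / p) * Φ t ^ (2 * (1 / q)) := by
      rw [← ENNReal.rpow_add_of_nonneg _ _ ha0.le (by positivity)]
      congr 1; linarith
    have e2 : Φb ^ (2 * (1 / q)) * Φb ^ (-(1 / q + 1)) = Φb ^ (-(1 / p)) := by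
      rw [← ENNReal.rpow_add _ _ hb0 hbt]
      congr 1; linarith
    calc f t * (Φ t / H t) ^ (1 / q + 1) ≤ f t * (2 * (Φ t * Φb⁻¹)) ^ (1 / q + 1) := by gcongr
      _ = 2 ^ (1 / q + 1) * ((f t * Φ t ^ (1 / p)) * (Φ t ^ (2 * (1 / q)) * Φb ^ (-(1 / q + 1)))) := by
          rw [ENNReal.mul_rpow_of_nonneg _ _ (by positivity),
            ENNReal.mul_rpow_of_nonneg _ _ (by positivity), e1, ENNReal.inv_rpow, ← ENNReal.rpow_neg]
          ring
      _ ≤ 2 ^ (1 / q + 1) * ((∫⁻ s in IbSet b, f s ^ p * φ s) ^ (1 / p) *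
            (Φb ^ (2 * (1 / q)) * Φb ^ (-(1 / q + 1)))) := by gcongr
      _ = _ := by rw [e2]

lemma core2 (p q : ℝ) (hpq : p.HolderConjugate q) : ∃ K : ℝ≥0∞, K ≠ ⊤ ∧ K ≠ 0 ∧
    ∀ (b : ℝ≥0∞) (φ d f g : ℝ → ℝ≥0∞),
    Measurable φ → Measurable d → Antitone f → Measurable g →
    (∀ t ∈ IbSet b, intPhi φ t ≠ 0) → (∀ t ∈ IbSet b, intPhi φ t ≤ intPhi d t) →
    (∀ t ∈ IbSet b, intPhi d t ≠ ⊤) →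
    ∫⁻ t in IbSet b, f t * g t * (intPhi φ t / intPhi d t) ^ (1 / q + 1) ≤
      K * (∫⁻ t in IbSet b, f t ^ p * φ t) ^ (1 / p) *
        ((∫⁻ t in IbSet b, intPhi g t ^ q * (intPhi φ t * intPhi d t ^ (-(q + 1)) * d t)) ^ (1 / q) +
          (∫⁻ t in IbSet b, g t) / (∫⁻ t in IbSet b, φ t) ^ (1 / p)) := by
  have hp := hpq.lt
  have hp0 : 0 < p := hpq.pos
  have hq0 : 0 < q := hpq.symm.pos
  have hsum : 1 / p + 1 / q = 1 := by simpa using hpq.inv_add_inv_eq_one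
  have hc0 : 0 < 1 / q := by positivity
  have ha0 : 0 < 1 / p := by positivity
  obtain ⟨K, hK, hKL⟩ := L2 p hp
  refine ⟨2 ^ (1 / q + 3) * K ^ (1 / p) + 2 ^ (1 / q + 1), ?_, ?_, ?_⟩
  · refine ENNReal.add_ne_top.2 ⟨ENNReal.mul_ne_top ?_ ?_, ?_⟩
    · exact ENNReal.rpow_ne_top_of_nonneg (by positivity) (by simp)
    · exact ENNReal.rpow_ne_top_of_nonneg (by positivity) hK
    · exact ENNReal.rpow_ne_top_of_nonneg (by positivity) (by simp)
  · have : (2 : ℝ≥0∞) ^ (1 / q + 1) ≠ 0 := (ENNReal.rpow_pos (by simp) (by simp)).ne'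
    exact fun h => this (add_eq_zero.1 h).2
  intro b φ d f g hφ hd hf hg hΦ0 hΦH hH
  have hI : MeasurableSet (IbSet b) := measJ b 0
  have hfm : Measurable f := hf.measurable
  have hH0 : ∀ t ∈ IbSet b, intPhi d t ≠ 0 := fun t ht h =>
    hΦ0 t ht (le_antisymm (h ▸ hΦH t ht) bot_le)
  set w : ℝ → ℝ≥0∞ := fun s => f s ^ p * intPhi φ s ^ (p - 1) * φ s with hw
  have hwm : Measurable w := ((hfm.pow_const _).mul ((intPhi_meas φ).pow_const _)).mul hφ
  have hBm : Measurable (intPhi w) := intPhi_meas _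
  have hΦm : Measurable (intPhi φ) := intPhi_meas _
  have hHm : Measurable (intPhi d) := intPhi_meas _
  have hGm : Measurable (intPhi g) := intPhi_meas _
  set X : ℝ → ℝ≥0∞ := fun s => (intPhi w s) ^ (1 / p) *
          intPhi φ s ^ (1 / q) * intPhi d s ^ (-(1 / q + 2)) * d s with hX
  have hXm : Measurable X :=
    (((hBm.pow_const _).mul (hΦm.pow_const _)).mul (hHm.pow_const _)).mul hd
  set N := (∫⁻ t in IbSet b, f t ^ p * φ t) ^ (1 / p) with hN
  set Φb := ∫⁻ t in IbSet b, φ t with hΦb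
  have hTm : Measurable fun t => ∫⁻ s in {s : ℝ | t < s ∧ ENNReal.ofReal s < b}, X s :=
    (tail_anti b X).measurable
  -- first estimate
  have s1 : ∫⁻ t in IbSet b, f t * g t * (intPhi φ t / intPhi d t) ^ (1 / q + 1) ≤
      2 ^ (1 / q + 3) * (∫⁻ s in IbSet b, X s * intPhi g s) +
      2 ^ (1 / q + 1) * (N * Φb ^ (-(1 / p))) * ∫⁻ t in IbSet b, g t := by
    have : ∫⁻ s in IbSet b, X s * intPhi g s = ∫⁻ t in IbSet b, g t *
      ∫⁻ s in {s : ℝ | t < s ∧ ENNReal.ofReal s < b}, X s := (tonelliJ b g X hg hXm).symm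
    have hgT : Measurable fun t => g t *
      ∫⁻ s in {s : ℝ | t < s ∧ ENNReal.ofReal s < b}, X s := hg.mul hTm
    rw [this, ← lintegral_const_mul _ hgT, ← lintegral_const_mul _ hg,
      ← lintegral_add_left (hgT.const_mul _)]
    refine setLIntegral_mono' hI fun t ht => ?_
    have h1 := core1 p q hpq b φ d f hφ hd hf hΦ0 hΦH hH ht
    calc _ = g t * (f t * (intPhi φ t / intPhi d t) ^ (1 / q + 1)) := by ring
      _ ≤ g t * _ := mul_le_mul_right h1 _
      _ = _ := by rw [mul_add]; ring
  -- Holder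
  have s2 : ∫⁻ s in IbSet b, X s * intPhi g s ≤
      (∫⁻ s in IbSet b, intPhi w s * (intPhi d s ^ (-p) * d s)) ^ (1 / p) *
      (∫⁻ t in IbSet b, intPhi g t ^ q * (intPhi φ t * intPhi d t ^ (-(q + 1)) * d t)) ^ (1 / q) := by
    have h1 := ENNReal.lintegral_mul_le_Lp_mul_Lq (volume.restrict (IbSet b)) hpq
      (f := fun s => intPhi w s ^ (1 / p) * (intPhi d s ^ (-(1 : ℝ)) * d s ^ (1 / p)))
      (g := fun s => intPhi g s * (intPhi φ s ^ (1 / q) * intPhi d s ^ (-(1 / q + 1)) * d s ^ (1 / q)))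
      ((hBm.pow_const _).mul ((hHm.pow_const _).mul (hd.pow_const _))).aemeasurable
      (hGm.mul (((hΦm.pow_const _).mul (hHm.pow_const _)).mul (hd.pow_const _))).aemeasurable
    refine le_trans (le_of_eq ?_) (h1.trans (le_of_eq ?_))
    · refine setLIntegral_congr_fun hI fun s hs => ?_
      simp only [hX, Pi.mul_apply]
      have e1 : d s = d s ^ (1 / p) * d s ^ (1 / q) := by
        rw [← ENNReal.rpow_add_of_nonneg _ _ ha0.le hc0.le, hsum, ENNReal.rpow_one]
      have e2 : intPhi d s ^ (-(1 / q + 2)) = intPhi d s ^ (-(1 : ℝ)) * intPhi d s ^ (-(1 / q + 1)) := by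
        rw [← ENNReal.rpow_add _ _ (hH0 s hs) (hH s hs)]
        congr 1; ring
      rw [e2]
      calc _ = intPhi w s ^ (1 / p) * intPhi φ s ^ (1 / q) *
            (intPhi d s ^ (-(1 : ℝ)) * intPhi d s ^ (-(1 / q + 1))) *
            (d s ^ (1 / p) * d s ^ (1 / q)) * intPhi g s := by rw [← e1]
        _ = _ := by ring
    · congr 2
      · refine setLIntegral_congr_fun hI fun s hs => ?_
        rw [ENNReal.mul_rpow_of_nonneg _ _ hp0.le, ENNReal.mul_rpow_of_nonneg _ _ hp0.le,
          ← ENNReal.rpow_mul, ← ENNReal.rpow_mul, ← ENNReal.rpow_mul,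
          one_div_mul_cancel hp0.ne', ENNReal.rpow_one, ENNReal.rpow_one, neg_one_mul]
      · refine setLIntegral_congr_fun hI fun s hs => ?_
        have : -(1 / q + 1) * q = -(q + 1) := by field_simp; ring
        rw [ENNReal.mul_rpow_of_nonneg _ _ hq0.le, ENNReal.mul_rpow_of_nonneg _ _ hq0.le,
          ENNReal.mul_rpow_of_nonneg _ _ hq0.le,
          ← ENNReal.rpow_mul, ← ENNReal.rpow_mul, ← ENNReal.rpow_mul,
          one_div_mul_cancel hq0.ne', ENNReal.rpow_one, ENNReal.rpow_one, this]
  -- B term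
  have s3 : ∫⁻ s in IbSet b, intPhi w s * (intPhi d s ^ (-p) * d s) ≤
      K * ∫⁻ t in IbSet b, f t ^ p * φ t := by
    have h1 := tonelliJ b w (fun s => intPhi d s ^ (-p) * d s) hwm ((hHm.pow_const _).mul hd)
    calc _ = ∫⁻ s in IbSet b, (intPhi d s ^ (-p) * d s) * ∫⁻ t in Ioo 0 s, w t := by
          refine lintegral_congr fun s => ?_
          rw [mul_comm]; rfl
      _ = _ := h1.symm
      _ ≤ ∫⁻ t in IbSet b, K * (f t ^ p * φ t) := by
          refine setLIntegral_mono' hI fun t ht => ?_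
          have h2 := hKL b d hd (fun t ht => ⟨hH0 t ht, hH t ht⟩) t ht
          have h3 : intPhi φ t ^ (p - 1) * intPhi d t ^ (1 - p) ≤ 1 := by
            calc _ ≤ intPhi d t ^ (p - 1) * intPhi d t ^ (1 - p) := by
                  gcongr ?_ * _
                  exact ENNReal.rpow_le_rpow (hΦH t ht) (by linarith)
              _ = 1 := by
                  rw [← ENNReal.rpow_add _ _ (hH0 t ht) (hH t ht)]
                  simp
          calc _ ≤ w t * (K * intPhi d t ^ (1 - p)) := mul_le_mul_right h2 _
            _ = K * (f t ^ p * φ t) * (intPhi φ t ^ (p - 1) * intPhi d t ^ (1 - p)) := by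
                simp only [hw]; ring
            _ ≤ K * (f t ^ p * φ t) * 1 := by gcongr
            _ = _ := mul_one _
      _ = _ := lintegral_const_mul _ ((hfm.pow_const _).mul hφ)
  have s4 : (∫⁻ s in IbSet b, intPhi w s * (intPhi d s ^ (-p) * d s)) ^ (1 / p) ≤
      K ^ (1 / p) * N := by
    have := ENNReal.rpow_le_rpow s3 (z := 1 / p) ha0.le
    rwa [ENNReal.mul_rpow_of_nonneg _ _ ha0.le] at this
  set Y := (∫⁻ t in IbSet b, intPhi g t ^ q * (intPhi φ t * intPhi d t ^ (-(q + 1)) * d t)) ^ (1 / q)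
    with hY
  set Γ := ∫⁻ t in IbSet b, g t with hΓ
  have e5 : Γ / Φb ^ (1 / p) = Φb ^ (-(1 / p)) * Γ := by
    rw [ENNReal.rpow_neg, div_eq_mul_inv, mul_comm]
  rw [e5]
  calc _ ≤ 2 ^ (1 / q + 3) * (K ^ (1 / p) * N * Y) + 2 ^ (1 / q + 1) * (N * Φb ^ (-(1 / p))) * Γ := by
        refine s1.trans ?_
        gcongr
        exact s2.trans (by gcongr)
    _ = (2 ^ (1 / q + 3) * K ^ (1 / p)) * N * Y + 2 ^ (1 / q + 1) * N * (Φb ^ (-(1 / p)) * Γ) := by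
        ring
    _ ≤ (2 ^ (1 / q + 3) * K ^ (1 / p) + 2 ^ (1 / q + 1)) * N * Y +
        (2 ^ (1 / q + 3) * K ^ (1 / p) + 2 ^ (1 / q + 1)) * N * (Φb ^ (-(1 / p)) * Γ) := by
        gcongr
        · exact le_self_add
        · exact le_add_self
    _ = _ := by rw [mul_add]

theorem statement2 (p : ℝ) (hp : 1 < p) (b : ℝ≥0∞) (hb : 0 < b)
    (φ : ℝ → ℝ≥0∞) (hφ : IsNontrivialWeight b p φ) :
    ∃ C : ℝ, 0 < C ∧ ∀ f g : ℝ → ℝ≥0∞, AntitoneOn f (IbSet b) → Measurable g →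
      ∫⁻ t in IbSet b, f t * g t * (Pavg φ t / PQp b p φ t) ^ (1 / (p / (p - 1)) + 1) ≤
        ENNReal.ofReal C * (∫⁻ t in IbSet b, f t ^ p * φ t) ^ (1 / p) *
          ((∫⁻ t in IbSet b, (Pavg g t) ^ (p / (p - 1)) * dualWeight' b p φ t) ^
              (1 / (p / (p - 1))) +
            (∫⁻ t in IbSet b, g t) / (∫⁻ t in IbSet b, φ t) ^ (1 / p)) := by
  obtain ⟨⟨hφm, hφpos, hφloc⟩, -, -⟩ := hφ
  have hp0 : 0 < p := by linarith
  have hI : MeasurableSet (IbSet b) := measJ b 0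
  have hpq : p.HolderConjugate (p / (p - 1)) := Real.HolderConjugate.conjExponent hp
  set q := p / (p - 1) with hq
  have hq0 : 0 < q := hpq.symm.pos
  obtain ⟨K, hKt, hK0, hK⟩ := core2 p q hpq
  refine ⟨K.toReal, ENNReal.toReal_pos hK0 hKt, fun f₀ g hf₀ hg => ?_⟩
  rw [ENNReal.ofReal_toReal hKt]
  -- ratio
  have hratio : ∀ t ∈ IbSet b, Pavg φ t / PQp b p φ t = intPhi φ t / DPhi b p φ t := by
    intro t ht
    have h0 : (ENNReal.ofReal t)⁻¹ ≠ 0 := ENNReal.inv_ne_zero.2 ENNReal.ofReal_ne_top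
    have h1 : (ENNReal.ofReal t)⁻¹ ≠ ⊤ := ENNReal.inv_ne_top.2 (ENNReal.ofReal_pos.2 ht.1).ne'
    exact ENNReal.mul_div_mul_left _ _ h0 h1
  by_cases hfin : ∃ t₀ ∈ IbSet b, DPhi b p φ t₀ ≠ ⊤
  swap
  · push Not at hfin
    have : ∫⁻ t in IbSet b, f₀ t * g t * (Pavg φ t / PQp b p φ t) ^ (1 / q + 1) = 0 := by
      rw [← lintegral_zero (μ := volume.restrict (IbSet b))]
      refine setLIntegral_congr_fun hI fun t ht => ?_
      rw [hratio t ht, hfin t ht, ENNReal.div_top, ENNReal.zero_rpow_of_pos (by positivity), mul_zero]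
    rw [this]
    exact zero_le
  have hDfin : ∀ t ∈ IbSet b, DPhi b p φ t ≠ ⊤ := by
    obtain ⟨t₀, ht₀, hD₀⟩ := hfin
    rw [DPhi, ENNReal.add_ne_top] at hD₀
    have hT₀ : tailP b p φ t₀ ≠ ⊤ := by
      intro h
      apply hD₀.2
      rw [h, ENNReal.mul_top]
      exact (ENNReal.ofReal_pos.2 (Real.rpow_pos_of_pos ht₀.1 p)).ne'
    intro t ht
    rw [DPhi, ENNReal.add_ne_top]
    constructor
    · refine ne_top_of_le_ne_top ?_ (intPhi_split φ (u := t₀) (t := t))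
      refine ENNReal.add_ne_top.2 ⟨hD₀.1, ?_⟩
      exact ne_top_of_le_ne_top (hφloc t₀ t ht₀.1 ht.2).ne (lintegral_mono_set Ioo_subset_Icc_self)
    · refine ENNReal.mul_ne_top ENNReal.ofReal_ne_top ?_
      have hsub : {s : ℝ | t < s ∧ ENNReal.ofReal s < b} ⊆
          Icc t t₀ ∪ {s : ℝ | t₀ < s ∧ ENNReal.ofReal s < b} := by
        intro s hs
        rcases le_or_gt s t₀ with h | h
        · exact Or.inl ⟨hs.1.le, h⟩
        · exact Or.inr ⟨h, hs.2⟩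
      refine ne_top_of_le_ne_top ?_ ((lintegral_mono_set hsub).trans (lintegral_union_le _ _ _))
      refine ENNReal.add_ne_top.2 ⟨?_, hT₀⟩
      have : ∫⁻ s in Icc t t₀, φ s * ENNReal.ofReal (s ^ (-p)) ≤
          ∫⁻ s in Icc t t₀, φ s * ENNReal.ofReal (t ^ (-p)) := by
        refine setLIntegral_mono' measurableSet_Icc fun s hs => ?_
        have h5 : s ^ (-p) ≤ t ^ (-p) := Real.rpow_le_rpow_of_nonpos ht.1 hs.1 (by linarith)
        exact mul_le_mul' le_rfl (ENNReal.ofReal_le_ofReal h5)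
      refine ne_top_of_le_ne_top ?_ this
      rw [lintegral_mul_const _ hφm]
      exact ENNReal.mul_ne_top (hφloc t t₀ ht.1 ht₀.2).ne ENNReal.ofReal_ne_top
  set d := Qp b p φ with hd
  have hdm : Measurable d := by
    have h1 : Measurable fun s : ℝ => ENNReal.ofReal (p * s ^ (p - 1)) := by fun_prop
    exact h1.mul (tail_anti b _).measurable
  have hDH : ∀ t ∈ IbSet b, DPhi b p φ t = intPhi d t := fun t ht => DPhi_eq b p hp φ hφm ht
  -- the monotone extension of f
  set f : ℝ → ℝ≥0∞ := fun t => if t ≤ 0 then ⊤ else if ENNReal.ofReal t < b then f₀ t else 0 with hf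
  have hfeq : ∀ t ∈ IbSet b, f t = f₀ t := by
    intro t ht
    simp only [hf]
    rw [if_neg (not_le.2 ht.1), if_pos ht.2]
  have hfa : Antitone f := by
    intro s t hst
    rcases le_or_gt s 0 with hs | hs
    · have : f s = ⊤ := if_pos hs
      rw [this]; exact le_top
    · by_cases ht : ENNReal.ofReal t < b
      · have htI : t ∈ IbSet b := ⟨hs.trans_le hst, ht⟩
        have hsI : s ∈ IbSet b := ⟨hs, lt_of_le_of_lt (ENNReal.ofReal_le_ofReal hst) ht⟩
        rw [hfeq t htI, hfeq s hsI]
        exact hf₀ hsI htI hst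
      · have : f t = 0 := by
          simp only [hf]
          rw [if_neg (not_le.2 (hs.trans_le hst)), if_neg ht]
        rw [this]; exact zero_le
  have hΦ0 : ∀ t ∈ IbSet b, intPhi φ t ≠ 0 := by
    intro t ht h
    have hsub : Ioo 0 t ⊆ IbSet b := fun s hs =>
      ⟨hs.1, lt_of_le_of_lt (ENNReal.ofReal_le_ofReal hs.2.le) ht.2⟩
    rw [intPhi, setLIntegral_eq_zero_iff measurableSet_Ioo hφm] at h
    have h2 : volume (Ioo 0 t) = 0 := by
      refine measure_mono_null (fun s hs => ?_) (ae_iff.1 h)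
      have := (hφpos s (hsub hs)).1.ne'
      simp only [Set.mem_ofPred_eq]
      exact fun h3 => this (h3 hs)
    rw [Real.volume_Ioo, sub_zero] at h2
    exact (ENNReal.ofReal_pos.2 ht.1).ne' h2
  have main := hK b φ d f g hφm hdm hfa hg hΦ0
    (fun t ht => by rw [← hDH t ht]; exact le_self_add)
    (fun t ht => by rw [← hDH t ht]; exact hDfin t ht)
  have e1 : ∫⁻ t in IbSet b, f₀ t * g t * (Pavg φ t / PQp b p φ t) ^ (1 / q + 1) =
      ∫⁻ t in IbSet b, f t * g t * (intPhi φ t / intPhi d t) ^ (1 / q + 1) := by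
    refine setLIntegral_congr_fun hI fun t ht => ?_
    rw [hratio t ht, hDH t ht, hfeq t ht]
  have e2 : ∫⁻ t in IbSet b, f₀ t ^ p * φ t = ∫⁻ t in IbSet b, f t ^ p * φ t := by
    refine setLIntegral_congr_fun hI fun t ht => ?_
    rw [hfeq t ht]
  have e3 : ∫⁻ t in IbSet b, (Pavg g t) ^ q * dualWeight' b p φ t =
      ∫⁻ t in IbSet b, intPhi g t ^ q * (intPhi φ t * intPhi d t ^ (-(q + 1)) * d t) := by
    refine setLIntegral_congr_fun hI fun t ht => ?_
    have hDt := hDfin t ht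
    rw [hDH t ht] at hDt
    have ht0 : ENNReal.ofReal t ≠ 0 := (ENNReal.ofReal_pos.2 ht.1).ne'
    have htt : ENNReal.ofReal t ≠ ⊤ := ENNReal.ofReal_ne_top
    have hi0 : (ENNReal.ofReal t)⁻¹ ≠ 0 := ENNReal.inv_ne_zero.2 htt
    have hit : (ENNReal.ofReal t)⁻¹ ≠ ⊤ := ENNReal.inv_ne_top.2 ht0
    rw [dualWeight', PQp, hDH t ht, ← hq]
    have a1 : Pavg g t = (ENNReal.ofReal t)⁻¹ * intPhi g t := rfl
    have a2 : Pavg φ t = (ENNReal.ofReal t)⁻¹ * intPhi φ t := rfl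
    rw [a1, a2, ENNReal.mul_rpow_of_nonneg _ _ hq0.le, div_eq_mul_inv, ← ENNReal.rpow_neg,
      ENNReal.mul_rpow_of_ne_top hit hDt]
    set τ := (ENNReal.ofReal t)⁻¹ with hτ
    have a3 : τ ^ q * τ * τ ^ (-(q + 1)) = 1 := by
      nth_rewrite 2 [← ENNReal.rpow_one τ]
      rw [← ENNReal.rpow_add _ _ hi0 hit, ← ENNReal.rpow_add _ _ hi0 hit]
      simp
    calc _ = (τ ^ q * τ * τ ^ (-(q + 1))) *
          (intPhi g t ^ q * (intPhi φ t * intPhi d t ^ (-(q + 1)) * d t)) := by ring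
      _ = _ := by rw [a3, one_mul]
  rw [e1, e2, e3]
  exact main

end
end

section
/- Fix 1 < p < ∞ and b ∈ (0, ∞], let φ be a non-trivial weight on I_b = (0, b), and set ψ := (Pφ)(Q_pφ)/[(PQ_p)(φ)]^{p'+1}. Then there exists C > 0, independent of f and g, such that for every nonnegative increasing f and every g ∈ M₊(I_b): ∫₀ᵇ f(t) g(t) [(Q_pφ)(t)/((PQ_p)(φ))(t)]^{(1/p')+1} dt ≤ C (∫₀ᵇ f(t)^p φ(t) t^{-p} dt)^{1/p} · (∫₀ᵇ (∫ₜᵇ g(s) ds)^{p'} ψ(t) dt)^{1/p'}. -/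
open MeasureTheory Set ENNReal Filter

noncomputable section

/-- the tail interval -/
abbrev Tb (b : ℝ≥0∞) (t : ℝ) : Set ℝ := {s : ℝ | t < s ∧ ENNReal.ofReal s < b}

lemma Ib_meas (b : ℝ≥0∞) : MeasurableSet (IbSet b) := by
  have h1 : Measurable fun t : ℝ => ENNReal.ofReal t := ENNReal.measurable_ofReal
  exact measurableSet_Ioi.inter (h1 measurableSet_Iio)

lemma Tb_meas (b : ℝ≥0∞) (t : ℝ) : MeasurableSet (Tb b t) := by
  have h1 : Measurable fun t : ℝ => ENNReal.ofReal t := ENNReal.measurable_ofReal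
  exact measurableSet_Ioi.inter (h1 measurableSet_Iio)

lemma Tb_anti (b : ℝ≥0∞) {s t : ℝ} (h : s ≤ t) : Tb b t ⊆ Tb b s :=
  fun _ hx => ⟨h.trans_lt hx.1, hx.2⟩

lemma Tb_sub {b : ℝ≥0∞} {t : ℝ} (h : t ∈ IbSet b) : Tb b t ⊆ IbSet b :=
  fun _ hx => ⟨h.1.trans hx.1, hx.2⟩

lemma Ib_mid {b : ℝ≥0∞} {t x : ℝ} (h : t ∈ IbSet b) (h0 : 0 < x) (hx : x ≤ t) : x ∈ IbSet b :=
  ⟨h0, (ENNReal.ofReal_le_ofReal hx).trans_lt h.2⟩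

/-- `N` is a decreasing primitive of `h` on `I_b`. -/
structure DecPrim (b : ℝ≥0∞) (N h : ℝ → ℝ≥0∞) : Prop where
  mN : Measurable N
  mh : Measurable h
  fin : ∀ t ∈ IbSet b, N t ≠ ⊤
  pos : ∀ t ∈ IbSet b, N t ≠ 0
  eq : ∀ t ∈ IbSet b, ∀ r ∈ IbSet b, t ≤ r → N t = N r + ∫⁻ s in Ioc t r, h s

lemma DecPrim.anti {b : ℝ≥0∞} {N h : ℝ → ℝ≥0∞} (H : DecPrim b N h) {t r : ℝ}
    (ht : t ∈ IbSet b) (hr : r ∈ IbSet b) (htr : t ≤ r) : N r ≤ N t := by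
  rw [H.eq t ht r hr htr]; exact le_self_add

lemma DecPrim.ivt {b : ℝ≥0∞} {N h : ℝ → ℝ≥0∞} (H : DecPrim b N h) {t r : ℝ}
    (ht : t ∈ IbSet b) (hr : r ∈ IbSet b) (htr : t ≤ r) {y : ℝ≥0∞} (h1 : N r ≤ y) (h2 : y ≤ N t) :
    ∃ x ∈ Icc t r, N x = y := by
  have hI : ∫⁻ s in Ioc t r, h s ≠ ⊤ := by
    intro h0
    have := H.eq t ht r hr htr
    rw [h0] at this
    exact H.fin t ht (by simp [this])
  have hint : IntegrableOn (fun s => (h s).toReal) (uIcc t r) := by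
    rw [uIcc_of_le htr, integrableOn_Icc_iff_integrableOn_Ioc]
    exact integrable_toReal_of_lintegral_ne_top H.mh.aemeasurable hI
  have hc := intervalIntegral.continuousOn_primitive_interval_left hint
  rw [uIcc_of_le htr] at hc
  have hval : ∀ x ∈ Icc t r, N x = N r + ENNReal.ofReal (∫ s in x..r, (h s).toReal) := by
    intro x hx
    have hxI : x ∈ IbSet b := Ib_mid hr (ht.1.trans_le hx.1) hx.2
    have hfin : ∫⁻ s in Ioc x r, h s ≠ ⊤ :=
      ne_top_of_le_ne_top hI (lintegral_mono_set (Ioc_subset_Ioc_left hx.1))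
    rw [H.eq x hxI r hr hx.2, intervalIntegral.integral_of_le hx.2,
      integral_toReal H.mh.aemeasurable (ae_lt_top H.mh hfin), ENNReal.ofReal_toReal hfin]
  have hcN : ContinuousOn N (Icc t r) := by
    refine ContinuousOn.congr ?_ hval
    exact continuousOn_const.add (ENNReal.continuous_ofReal.comp_continuousOn hc)
  obtain ⟨x, hx, hxy⟩ := intermediate_value_Icc' htr hcN ⟨h1, h2⟩
  exact ⟨x, hx, hxy⟩

lemma DecPrim.up {b : ℝ≥0∞} {N h : ℝ → ℝ≥0∞} (H : DecPrim b N h)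
    (unb : ∀ M : ℝ≥0∞, M ≠ ⊤ → ∃ t ∈ IbSet b, M ≤ N t) {s : ℝ} (hs : s ∈ IbSet b)
    {y : ℝ≥0∞} (hy : y ≠ ⊤) (h1 : N s ≤ y) : ∃ x ∈ IbSet b, x ≤ s ∧ N x = y := by
  obtain ⟨t, ht, hty⟩ := unb y hy
  rcases le_total t s with h | h
  · obtain ⟨x, hx, hxy⟩ := H.ivt ht hs h h1 hty
    exact ⟨x, Ib_mid hs (ht.1.trans_le hx.1) hx.2, hx.2, hxy⟩
  · exact ⟨s, hs, le_rfl, le_antisymm h1 (hty.trans (H.anti hs ht h))⟩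

/-- lower bound -/
lemma DecPrim.low {b : ℝ≥0∞} {N h : ℝ → ℝ≥0∞} (H : DecPrim b N h)
    (unb : ∀ M : ℝ≥0∞, M ≠ ⊤ → ∃ t ∈ IbSet b, M ≤ N t) {t : ℝ} (ht : t ∈ IbSet b)
    {e : ℝ} (he : 0 ≤ e) :
    N t * ((2 * N t) ^ e)⁻¹ ≤ ∫⁻ x in Ioo 0 t, h x * (N x ^ e)⁻¹ := by
  have hf := H.fin t ht
  obtain ⟨r, hr, hrt, hN⟩ := H.up unb ht (y := 2 * N t) (ENNReal.mul_ne_top (by simp) hf)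
    (by rw [two_mul]; exact le_self_add)
  have h1 : ∫⁻ s in Ioc r t, h s = N t := by
    have := H.eq r hr t ht hrt
    rw [hN, two_mul] at this
    exact ((ENNReal.add_right_inj hf).1 this).symm
  calc N t * ((2 * N t) ^ e)⁻¹ = ∫⁻ x in Ioo r t, h x * ((2 * N t) ^ e)⁻¹ := by
        rw [lintegral_mul_const _ H.mh, setLIntegral_congr Ioo_ae_eq_Ioc, h1]
    _ ≤ ∫⁻ x in Ioo r t, h x * (N x ^ e)⁻¹ := by
        refine setLIntegral_mono' measurableSet_Ioo fun x hx => ?_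
        have : N x ≤ 2 * N t := by
          rw [← hN]; exact H.anti hr (Ib_mid ht (hr.1.trans hx.1) hx.2.le) hx.1.le
        gcongr
    _ ≤ _ := lintegral_mono_set (Ioo_subset_Ioo_left hr.1.le)

/-- the constant -/
def cp (p : ℝ) : ℝ≥0∞ := 2 * (1 - 2 * (2 ^ p)⁻¹)⁻¹

lemma cp_ne_top {p : ℝ} (hp : 1 < p) : cp p ≠ ⊤ := by
  unfold cp
  refine ENNReal.mul_ne_top (by simp) (ENNReal.inv_ne_top.2 ?_)
  have h : (2 : ℝ≥0∞) < 2 ^ p := by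
    calc (2 : ℝ≥0∞) = 2 ^ (1 : ℝ) := by simp
      _ < 2 ^ p := ENNReal.rpow_lt_rpow_of_exponent_lt (by norm_num) (by simp) hp
  have : (2 : ℝ≥0∞) * (2 ^ p)⁻¹ < 1 := by
    rw [← div_eq_mul_inv]
    exact ENNReal.div_lt_of_lt_mul (by simpa using h)
  exact (tsub_pos_of_lt this).ne'

lemma DecPrim.high {b : ℝ≥0∞} {N h : ℝ → ℝ≥0∞} (H : DecPrim b N h)
    (unb : ∀ M : ℝ≥0∞, M ≠ ⊤ → ∃ t ∈ IbSet b, M ≤ N t) {s : ℝ} (hs : s ∈ IbSet b)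
    {p : ℝ} (hp : 1 < p) :
    ∫⁻ x in Ioo 0 s, h x * (N x ^ p)⁻¹ ≤ cp p * (N s ^ (p - 1))⁻¹ := by
  have hf := H.fin s hs
  have h0 := H.pos s hs
  have hex : ∀ n : ℕ, ∃ x ∈ IbSet b, x ≤ s ∧ N x = 2 ^ n * N s := fun n =>
    H.up unb hs (ENNReal.mul_ne_top (by simp) hf) (by
      calc N s = 1 * N s := by simp
        _ ≤ 2 ^ n * N s := by gcongr; exact one_le_pow₀ (by norm_num))
  choose σ hσI hσs hσN using hex
  set E : ℕ → Set ℝ := fun n => Ioc (σ (n + 1)) s ∩ {x | 2 ^ n * N s ≤ N x} with hE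
  have hEm : ∀ n, MeasurableSet (E n) := fun n =>
    measurableSet_Ioc.inter (measurableSet_le measurable_const H.mN)
  have hcov : Ioo 0 s ⊆ ⋃ n, E n := by
    intro x hx
    have hxI : x ∈ IbSet b := Ib_mid hs hx.1 hx.2.le
    have hex : ∃ n : ℕ, N x < 2 ^ (n + 1) * N s := by
      obtain ⟨n, hn⟩ := ENNReal.exists_nat_mul_gt h0 (H.fin x hxI)
      refine ⟨n, hn.trans_le ?_⟩
      gcongr
      have : n ≤ 2 ^ (n + 1) := (Nat.lt_two_pow_self.le).trans (Nat.pow_le_pow_right (by norm_num) (by omega))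
      exact_mod_cast this
    classical
    set n := Nat.find hex with hn
    have h1 : N x < 2 ^ (n + 1) * N s := Nat.find_spec hex
    refine mem_iUnion.2 ⟨n, ⟨?_, hx.2.le⟩, ?_⟩
    · by_contra hc
      have := H.anti hxI (hσI (n + 1)) (not_lt.1 hc)
      rw [hσN] at this
      exact absurd h1 (not_lt.2 this)
    · change 2 ^ n * N s ≤ N x
      rcases Nat.eq_zero_or_pos n with h2 | h2
      · rw [h2]; simpa using H.anti hxI hs hx.2.le
      · have := Nat.find_min hex (m := n - 1) (by omega)
        rw [Nat.sub_add_cancel h2] at this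
        exact not_lt.1 this
  have hterm : ∀ n, ∫⁻ x in E n, h x * (N x ^ p)⁻¹ ≤
      2 * (N s ^ (p - 1))⁻¹ * (2 * (2 ^ p)⁻¹) ^ n := by
    intro n
    calc ∫⁻ x in E n, h x * (N x ^ p)⁻¹ ≤ ∫⁻ x in E n, h x * ((2 ^ n * N s) ^ p)⁻¹ := by
          refine setLIntegral_mono' (hEm n) fun x hx => ?_
          have : 2 ^ n * N s ≤ N x := hx.2
          gcongr
      _ = (∫⁻ x in E n, h x) * ((2 ^ n * N s) ^ p)⁻¹ := lintegral_mul_const _ H.mh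
      _ ≤ (∫⁻ x in Ioc (σ (n + 1)) s, h x) * ((2 ^ n * N s) ^ p)⁻¹ := by
          gcongr
          exact inter_subset_left
      _ ≤ (2 ^ (n + 1) * N s) * ((2 ^ n * N s) ^ p)⁻¹ := by
          gcongr
          rw [← hσN, H.eq _ (hσI (n + 1)) s hs (hσs _)]
          exact le_add_self
      _ = 2 * (N s ^ (p - 1))⁻¹ * (2 * (2 ^ p)⁻¹) ^ n := by
          have e1 : N s ^ p = N s ^ (p - 1) * N s := by
            conv_lhs => rw [show p = (p - 1) + 1 by ring]
            rw [ENNReal.rpow_add _ _ h0 hf, ENNReal.rpow_one]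
          have e2 : ((2 : ℝ≥0∞) ^ n) ^ p = (2 ^ p) ^ n := by
            rw [← ENNReal.rpow_natCast, ← ENNReal.rpow_natCast, ← ENNReal.rpow_mul,
              ← ENNReal.rpow_mul, mul_comm]
          have e3 : N s ^ (p - 1) ≠ 0 := by simp [h0, hf]
          have e4 : N s ^ (p - 1) ≠ ⊤ := by simp [h0, hf]
          rw [ENNReal.mul_rpow_of_nonneg _ _ (by linarith), e2, e1, ENNReal.mul_inv, ENNReal.mul_inv,
            mul_pow, ENNReal.inv_pow, pow_succ]
          · calc 2 ^ n * 2 * N s * ((2 ^ p)⁻¹ ^ n * ((N s ^ (p - 1))⁻¹ * (N s)⁻¹))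
                = 2 * (N s ^ (p - 1))⁻¹ * (2 ^ n * (2 ^ p)⁻¹ ^ n) * (N s * (N s)⁻¹) := by ring
              _ = _ := by rw [ENNReal.mul_inv_cancel h0 hf, mul_one]
          · left; exact e3
          · left; exact e4
          · left; simp
          · right; exact mul_ne_zero e3 h0
  calc ∫⁻ x in Ioo 0 s, h x * (N x ^ p)⁻¹ ≤ ∫⁻ x in ⋃ n, E n, h x * (N x ^ p)⁻¹ :=
        lintegral_mono_set hcov
    _ ≤ ∑' n, ∫⁻ x in E n, h x * (N x ^ p)⁻¹ := lintegral_iUnion_le _ _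
    _ ≤ ∑' n, 2 * (N s ^ (p - 1))⁻¹ * (2 * (2 ^ p)⁻¹) ^ n := ENNReal.tsum_le_tsum hterm
    _ = cp p * (N s ^ (p - 1))⁻¹ := by
        rw [ENNReal.tsum_mul_left, ENNReal.tsum_geometric, cp]; ring

lemma swapT (b : ℝ≥0∞) {α β : ℝ → ℝ≥0∞} (hα : AEMeasurable α (volume.restrict (IbSet b)))
    (hβ : Measurable β) :
    ∫⁻ t in IbSet b, α t * ∫⁻ s in Ioo 0 t, β s = ∫⁻ s in IbSet b, β s * ∫⁻ t in Tb b s, α t := by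
  obtain ⟨α', hα', hae⟩ := hα
  have hm : Measurable (Function.uncurry fun t s : ℝ =>
      (Ioi s).indicator (fun t => α' t * β s) t) := by
    have : (Function.uncurry fun t s : ℝ => (Ioi s).indicator (fun t => α' t * β s) t) =
        {q : ℝ × ℝ | q.2 < q.1}.indicator (fun q => α' q.1 * β q.2) := by
      ext ⟨t, s⟩
      simp [indicator, Function.uncurry]
    rw [this]
    exact ((hα'.comp measurable_fst).mul (hβ.comp measurable_snd)).indicator
      (measurableSet_lt measurable_snd measurable_fst)
  calc ∫⁻ t in IbSet b, α t * ∫⁻ s in Ioo 0 t, β s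
      = ∫⁻ t in IbSet b, α' t * ∫⁻ s in Ioo 0 t, β s := by
        refine lintegral_congr_ae ?_
        filter_upwards [hae] with t ht
        rw [ht]
    _ = ∫⁻ t in IbSet b, ∫⁻ s in IbSet b, (Ioi s).indicator (fun t => α' t * β s) t := by
        refine setLIntegral_congr_fun (Ib_meas b) fun t ht => ?_
        have h1 : Ioo 0 t = Iio t ∩ IbSet b := by
          ext x; constructor
          · intro hx; exact ⟨hx.2, Ib_mid ht hx.1 hx.2.le⟩
          · intro hx; exact ⟨hx.2.1, hx.1⟩
        change α' t * _ = _
        rw [← lintegral_const_mul _ hβ, h1, ← Measure.restrict_restrict measurableSet_Iio,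
          ← lintegral_indicator measurableSet_Iio]
        refine lintegral_congr fun s => ?_
        simp [indicator]
    _ = ∫⁻ s in IbSet b, ∫⁻ t in IbSet b, (Ioi s).indicator (fun t => α' t * β s) t :=
        lintegral_lintegral_swap hm.aemeasurable
    _ = ∫⁻ s in IbSet b, β s * ∫⁻ t in Tb b s, α t := by
        refine setLIntegral_congr_fun (Ib_meas b) fun s hs => ?_
        have h1 : Tb b s = Ioi s ∩ IbSet b := by
          ext x; constructor
          · intro hx; exact ⟨hx.1, Tb_sub hs hx⟩
          · intro hx; exact ⟨hx.1, hx.2.2⟩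
        have h2 : ∫⁻ t in Tb b s, α t = ∫⁻ t in Tb b s, α' t :=
          lintegral_congr_ae (ae_restrict_of_ae_restrict_of_subset (Tb_sub hs) hae)
        change _ = β s * _
        rw [h2, ← lintegral_const_mul _ hα', lintegral_indicator measurableSet_Ioi,
          Measure.restrict_restrict measurableSet_Ioi, ← h1]
        simp only [mul_comm]

lemma Tb_exh (b : ℝ≥0∞) (m : ℝ → ℝ≥0∞) {t : ℝ} (ht : t ∈ IbSet b) {y : ℝ≥0∞}
    (hy : y < ∫⁻ s in Tb b t, m s) : ∃ r ∈ IbSet b, t < r ∧ y < ∫⁻ s in Ioc t r, m s := by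
  have h : Tb b t = ⋃ q : {q : ℚ // (q : ℝ) ∈ IbSet b}, Ioc t (q : ℝ) := by
    ext x
    simp only [mem_iUnion]
    constructor
    · intro hx
      obtain ⟨c, hc1, hc2⟩ := exists_between hx.2
      have hct : c ≠ ⊤ := hc2.ne_top
      have : x < c.toReal := (ENNReal.ofReal_lt_iff_lt_toReal (ht.1.trans hx.1).le hct).1 hc1
      obtain ⟨q, hq1, hq2⟩ := exists_rat_btwn this
      refine ⟨⟨q, (ht.1.trans hx.1).trans hq1, ?_⟩, hx.1, hq1.le⟩
      exact (ENNReal.ofReal_le_ofReal hq2.le).trans_lt (by rwa [ENNReal.ofReal_toReal hct])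
    · rintro ⟨q, hq⟩
      exact ⟨hq.1, (ENNReal.ofReal_le_ofReal hq.2).trans_lt q.2.2⟩
  rw [h, setLIntegral_iUnion_of_directed, lt_iSup_iff] at hy
  · obtain ⟨q, hq⟩ := hy
    refine ⟨q, q.2, ?_, hq⟩
    by_contra hc
    rw [Ioc_eq_empty hc] at hq
    simp at hq
  · intro q r
    rcases le_total (q : ℝ) r with h | h
    · exact ⟨r, Ioc_subset_Ioc_right h, subset_rfl⟩
    · exact ⟨q, subset_rfl, Ioc_subset_Ioc_right h⟩

lemma Ib_exh (b : ℝ≥0∞) (m : ℝ → ℝ≥0∞) {y : ℝ≥0∞}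
    (hy : y < ∫⁻ s in Tb b 0, m s) : ∃ r ∈ IbSet b, y < ∫⁻ s in Tb b r, m s := by
  have h : Tb b 0 = ⋃ q : {q : ℚ // (q : ℝ) ∈ IbSet b}, Tb b (q : ℝ) := by
    ext x
    simp only [mem_iUnion]
    constructor
    · intro hx
      obtain ⟨q, hq1, hq2⟩ := exists_rat_btwn hx.1
      exact ⟨⟨q, Ib_mid hx hq1 hq2.le⟩, hq2, hx.2⟩
    · rintro ⟨q, hq⟩
      exact ⟨q.2.1.trans hq.1, hq.2⟩
  rw [h, setLIntegral_iUnion_of_directed, lt_iSup_iff] at hy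
  · obtain ⟨q, hq⟩ := hy
    exact ⟨q, q.2, hq⟩
  · intro q r
    rcases le_total (q : ℝ) r with h | h
    · exact ⟨q, subset_rfl, Tb_anti b h⟩
    · exact ⟨r, Tb_anti b h, subset_rfl⟩

lemma J_int {p a r : ℝ} (hp : 1 < p) (ha : 0 < a) (har : a ≤ r) :
    ENNReal.ofReal (a ^ (-p)) = ENNReal.ofReal (r ^ (-p)) +
      ∫⁻ s in Ioc a r, ENNReal.ofReal (p * s ^ (-p - 1)) := by
  have h0 : (0 : ℝ) ∉ uIcc a r := by
    rw [uIcc_of_le har]; intro h; exact absurd h.1 (not_le.2 ha)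
  have hint : IntervalIntegrable (fun s : ℝ => p * s ^ (-p - 1)) volume a r :=
    (intervalIntegral.intervalIntegrable_rpow (Or.inr h0)).const_mul _
  have hval : ∫ s in a..r, p * s ^ (-p - 1) = a ^ (-p) - r ^ (-p) := by
    rw [intervalIntegral.integral_const_mul, integral_rpow (Or.inr ⟨by linarith, h0⟩)]
    have : p ≠ 0 := by linarith
    rw [show -p - 1 + 1 = -p by ring]
    field_simp
    ring
  have hle : r ^ (-p) ≤ a ^ (-p) := Real.rpow_le_rpow_of_nonpos ha har (by linarith)
  rw [← ofReal_integral_eq_lintegral_ofReal, ← intervalIntegral.integral_of_le har, hval,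
    ← ENNReal.ofReal_add (Real.rpow_nonneg (ha.le.trans har) _) (by linarith)]
  · congr 1; ring
  · exact (intervalIntegrable_iff_integrableOn_Ioc_of_le har).1 hint
  · filter_upwards [ae_restrict_mem measurableSet_Ioc] with s hs
    have := ha.trans hs.1
    positivity

lemma F_low {b : ℝ≥0∞} {m f : ℝ → ℝ≥0∞} {p : ℝ} (hp : 1 < p)
    (HB : DecPrim b (fun t => ∫⁻ s in Tb b t, m s) m) (hf : MonotoneOn f (IbSet b))
    {t : ℝ} (ht : t ∈ IbSet b) :
    f t ^ p * ((∫⁻ s in Tb b t, m s) / 2) ^ p ≤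
      ∫⁻ u in Tb b t, f u ^ p * m u * (∫⁻ s in Tb b u, m s) ^ (p - 1) := by
  set B : ℝ → ℝ≥0∞ := fun t => ∫⁻ s in Tb b t, m s with hB
  have hfin : B t ≠ ⊤ := HB.fin t ht
  have h0 : B t ≠ 0 := HB.pos t ht
  have hhalf : B t / 2 < B t := ENNReal.half_lt_self h0 hfin
  have hhalf0 : B t / 2 ≠ 0 := by simp [h0]
  have hhalft : B t / 2 ≠ ⊤ := hhalf.ne_top
  obtain ⟨r, hr, htr, hr2⟩ := Tb_exh b m ht hhalf
  have hBr : B r ≤ B t / 2 := by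
    have h1 := HB.eq t ht r hr htr.le
    change B t = B r + _ at h1
    by_contra hc
    have : B t / 2 + B t / 2 < B r + ∫⁻ s in Ioc t r, m s :=
      ENNReal.add_lt_add (not_le.1 hc) hr2
    rw [ENNReal.add_halves, ← h1] at this
    exact lt_irrefl _ this
  obtain ⟨x, hx, hxB⟩ := HB.ivt ht hr htr.le hBr hhalf.le
  change B x = B t / 2 at hxB
  have hxI : x ∈ IbSet b := Ib_mid hr (ht.1.trans_le hx.1) hx.2
  have hm : ∫⁻ s in Ioc t x, m s = B t / 2 := by
    have h1 := HB.eq t ht x hxI hx.1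
    change B t = B x + _ at h1
    rw [hxB] at h1
    nth_rw 1 [← ENNReal.add_halves (B t)] at h1
    exact ((ENNReal.add_right_inj hhalft).1 h1).symm
  have hsub : Ioc t x ⊆ Tb b t := fun u hu =>
    ⟨hu.1, (ENNReal.ofReal_le_ofReal hu.2).trans_lt hxI.2⟩
  calc f t ^ p * (B t / 2) ^ p = ∫⁻ u in Ioc t x, m u * (f t ^ p * (B t / 2) ^ (p - 1)) := by
        rw [lintegral_mul_const _ HB.mh, hm]
        conv_lhs => rw [show p = (p - 1) + 1 by ring]
        rw [ENNReal.rpow_add (p - 1) 1 hhalf0 hhalft, ENNReal.rpow_one, sub_add_cancel]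
        ring
    _ ≤ ∫⁻ u in Ioc t x, f u ^ p * m u * B u ^ (p - 1) := by
        refine setLIntegral_mono' measurableSet_Ioc fun u hu => ?_
        have huI : u ∈ IbSet b := Ib_mid hxI (ht.1.trans hu.1) hu.2
        have h1 : f t ≤ f u := hf ht huI hu.1.le
        have h2 : B t / 2 ≤ B u := by
          rw [← hxB]; exact HB.anti huI hxI hu.2
        have hp1 : 0 ≤ p - 1 := by linarith
        calc m u * (f t ^ p * (B t / 2) ^ (p - 1)) ≤ m u * (f u ^ p * B u ^ (p - 1)) := by
              gcongr
          _ = _ := by ring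
    _ ≤ _ := lintegral_mono_set hsub

/-- the constant of the core estimate -/
def cc (p : ℝ) : ℝ≥0∞ := 2 * 2 ^ (1 / (p / (p - 1)) + 2) * cp p ^ (1 / p)

lemma core {b : ℝ≥0∞} {m h H f g : ℝ → ℝ≥0∞} {p : ℝ} (hp : 1 < p)
    (HB : DecPrim b (fun t => ∫⁻ s in Tb b t, m s) m) (HH : DecPrim b H h)
    (unb : ∀ M : ℝ≥0∞, M ≠ ⊤ → ∃ t ∈ IbSet b, M ≤ H t)
    (hBH : ∀ t ∈ IbSet b, ∫⁻ s in Tb b t, m s ≤ H t)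
    (hf : MonotoneOn f (IbSet b)) (hg : Measurable g) :
    ∫⁻ t in IbSet b, f t * g t * ((∫⁻ s in Tb b t, m s) / H t) ^ (1 / (p / (p - 1)) + 1) ≤
      cc p * (∫⁻ t in IbSet b, f t ^ p * m t) ^ (1 / p) *
        (∫⁻ t in IbSet b, (∫⁻ s in Tb b t, g s) ^ (p / (p - 1)) *
          (h t * (∫⁻ s in Tb b t, m s) / H t ^ (p / (p - 1) + 1))) ^ (1 / (p / (p - 1))) := by
  unfold cc
  set q := p / (p - 1) with hq
  have hp0 : 0 < p := by linarith
  have hp1 : 0 < p - 1 := by linarith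
  have hpq : p.HolderConjugate q := Real.HolderConjugate.conjExponent hp
  have hq0 : 0 < q := div_pos hp0 hp1
  have he0 : 0 < 1 / q := by positivity
  have hpe : 1 / p + 1 / q = 1 := by
    rw [one_div, one_div]; exact hpq.inv_add_inv_eq_one
  set e := 1 / q with he
  have hqe : q * e = 1 := by rw [he]; field_simp
  set B : ℝ → ℝ≥0∞ := fun t => ∫⁻ s in Tb b t, m s with hB
  set G : ℝ → ℝ≥0∞ := fun t => ∫⁻ s in Tb b t, g s with hG
  set F : ℝ → ℝ≥0∞ := fun t => ∫⁻ u in Tb b t, f u ^ p * m u * B u ^ (p - 1) with hF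
  set ψ : ℝ → ℝ≥0∞ := fun t => h t * B t / H t ^ (q + 1) with hψ
  change ∫⁻ t in IbSet b, f t * g t * (B t / H t) ^ (e + 1) ≤
    2 * 2 ^ (e + 2) * cp p ^ (1 / p) * (∫⁻ t in IbSet b, f t ^ p * m t) ^ (1 / p) *
      (∫⁻ t in IbSet b, G t ^ q * ψ t) ^ e
  have hFanti : Antitone F := fun s t hst => lintegral_mono_set (Tb_anti b hst)
  have hGanti : Antitone G := fun s t hst => lintegral_mono_set (Tb_anti b hst)
  have mF : Measurable F := hFanti.measurable
  have mG : Measurable G := hGanti.measurable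
  have mB : Measurable B := HB.mN
  have mH : Measurable H := HH.mN
  have mh : Measurable h := HH.mh
  have mψ : Measurable ψ := (mh.mul mB).div (mH.pow_const _)
  set X : ℝ → ℝ≥0∞ := fun s => F s ^ (1 / p) * (H s)⁻¹ * h s ^ (1 / p) with hX
  have mX : Measurable X := ((mF.pow_const _).mul mH.inv).mul (mh.pow_const _)
  set k : ℝ → ℝ≥0∞ := fun s => X s * ψ s ^ e with hk
  have mk : Measurable k := mX.mul (mψ.pow_const _)
  -- pointwise estimate
  have key : ∀ t ∈ IbSet b, f t * (B t / H t) ^ (e + 1) ≤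
      2 * 2 ^ (e + 2) * ∫⁻ s in Ioo 0 t, k s := by
    intro t ht
    have hH0 := HH.pos t ht
    have hHt := HH.fin t ht
    have hB0 : B t ≠ 0 := HB.pos t ht
    have hBt : B t ≠ ⊤ := HB.fin t ht
    have h1 : ∀ s ∈ Ioo 0 t, f t * (B t / 2) * B t ^ e * (h s * (H s ^ (e + 2))⁻¹) ≤ k s := by
      intro s hs
      have hsI : s ∈ IbSet b := Ib_mid ht hs.1 hs.2.le
      have hHs0 := HH.pos s hsI
      have hHst := HH.fin s hsI
      have hFs : f t * (B t / 2) ≤ F s ^ (1 / p) := by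
        have h3 : (f t * (B t / 2)) ^ p ≤ F s := by
          rw [ENNReal.mul_rpow_of_nonneg _ _ hp0.le]
          exact (F_low hp HB hf ht).trans (hFanti hs.2.le)
        calc f t * (B t / 2) = ((f t * (B t / 2)) ^ p) ^ (1 / p) := by
              rw [← ENNReal.rpow_mul, mul_one_div_cancel hp0.ne', ENNReal.rpow_one]
          _ ≤ _ := by gcongr
      have hBs : B t ≤ B s := HB.anti hsI ht hs.2.le
      have hψe : ψ s ^ e = h s ^ e * B s ^ e * (H s ^ (1 + e))⁻¹ := by
        simp only [hψ]
        rw [ENNReal.div_rpow_of_nonneg _ _ he0.le, ENNReal.mul_rpow_of_nonneg _ _ he0.le,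
          ← ENNReal.rpow_mul, add_mul, hqe, one_mul, div_eq_mul_inv]
      have hh : h s = h s ^ (1 / p) * h s ^ e := by
        rw [← ENNReal.rpow_add_of_nonneg _ _ (by positivity) he0.le, hpe, ENNReal.rpow_one]
      have hHe : (H s ^ (e + 2))⁻¹ = (H s)⁻¹ * (H s ^ (1 + e))⁻¹ := by
        rw [show e + 2 = 1 + (1 + e) by ring, ENNReal.rpow_add _ _ hHs0 hHst, ENNReal.rpow_one,
          ENNReal.mul_inv (Or.inl hHs0) (Or.inl hHst)]
      calc f t * (B t / 2) * B t ^ e * (h s * (H s ^ (e + 2))⁻¹)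
          ≤ F s ^ (1 / p) * B s ^ e * (h s * (H s ^ (e + 2))⁻¹) := by gcongr
        _ = F s ^ (1 / p) * B s ^ e *
            ((h s ^ (1 / p) * h s ^ e) * ((H s)⁻¹ * (H s ^ (1 + e))⁻¹)) := by rw [← hh, hHe]
        _ = k s := by
          simp only [hk, hX]; rw [hψe]; ring
    have h2 : f t * (B t / 2) * B t ^ e * (H t * ((2 * H t) ^ (e + 2))⁻¹) ≤
        ∫⁻ s in Ioo 0 t, k s := by
      calc f t * (B t / 2) * B t ^ e * (H t * ((2 * H t) ^ (e + 2))⁻¹)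
          ≤ f t * (B t / 2) * B t ^ e * ∫⁻ s in Ioo 0 t, h s * (H s ^ (e + 2))⁻¹ := by
            gcongr
            exact HH.low unb ht (by positivity)
        _ = ∫⁻ s in Ioo 0 t, f t * (B t / 2) * B t ^ e * (h s * (H s ^ (e + 2))⁻¹) :=
            (lintegral_const_mul _ (mh.mul (mH.pow_const _).inv)).symm
        _ ≤ _ := setLIntegral_mono' measurableSet_Ioo h1
    refine le_trans (le_of_eq ?_) (mul_le_mul_right h2 _)
    have e1 : B t ^ (e + 1) = B t * B t ^ e := by
      rw [ENNReal.rpow_add _ _ hB0 hBt, ENNReal.rpow_one, mul_comm]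
    have e2 : H t ^ (e + 2) = H t * H t ^ (e + 1) := by
      rw [show e + 2 = 1 + (e + 1) by ring, ENNReal.rpow_add _ _ hH0 hHt, ENNReal.rpow_one]
    have c0 : (2 : ℝ≥0∞) ^ (e + 2) ≠ 0 := by simp
    have ct : (2 : ℝ≥0∞) ^ (e + 2) ≠ ⊤ := ENNReal.rpow_ne_top_of_nonneg (by positivity) (by simp)
    rw [ENNReal.div_rpow_of_nonneg _ _ (by positivity), e1, ENNReal.mul_rpow_of_nonneg _ _ (by positivity),
      e2, ENNReal.mul_inv (Or.inl c0) (Or.inl ct), ENNReal.mul_inv (Or.inl hH0) (Or.inl hHt),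
      div_eq_mul_inv, div_eq_mul_inv]
    symm
    calc 2 * 2 ^ (e + 2) * (f t * (B t * 2⁻¹) * B t ^ e *
          (H t * ((2 ^ (e + 2))⁻¹ * ((H t)⁻¹ * (H t ^ (e + 1))⁻¹))))
        = (2 * 2⁻¹) * (2 ^ (e + 2) * (2 ^ (e + 2))⁻¹) * (H t * (H t)⁻¹) *
          (f t * (B t * B t ^ e * (H t ^ (e + 1))⁻¹)) := by ring
      _ = _ := by
        rw [ENNReal.mul_inv_cancel c0 ct, ENNReal.mul_inv_cancel hH0 hHt,
          ENNReal.mul_inv_cancel (by simp) (by simp)]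
        simp
  have mf : AEMeasurable f (volume.restrict (IbSet b)) :=
    aemeasurable_restrict_of_monotoneOn (Ib_meas b) hf
  -- the norm of X
  have hXp : ∫⁻ s in IbSet b, X s ^ p ≤ cp p * ∫⁻ t in IbSet b, f t ^ p * m t := by
    have e1 : ∀ s, X s ^ p = h s * (H s ^ p)⁻¹ * F s := by
      intro s
      simp only [hX]
      rw [ENNReal.mul_rpow_of_nonneg _ _ hp0.le, ENNReal.mul_rpow_of_nonneg _ _ hp0.le,
        ← ENNReal.rpow_mul, ← ENNReal.rpow_mul, one_div_mul_cancel hp0.ne', ENNReal.rpow_one,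
        ENNReal.rpow_one, ENNReal.inv_rpow]
      ring
    have mα : AEMeasurable (fun u => f u ^ p * m u * B u ^ (p - 1)) (volume.restrict (IbSet b)) :=
      ((mf.pow_const _).mul HB.mh.aemeasurable).mul (mB.pow_const _).aemeasurable
    calc ∫⁻ s in IbSet b, X s ^ p = ∫⁻ s in IbSet b, h s * (H s ^ p)⁻¹ * F s := by simp only [e1]
      _ = ∫⁻ u in IbSet b, f u ^ p * m u * B u ^ (p - 1) *
            ∫⁻ s in Ioo 0 u, h s * (H s ^ p)⁻¹ :=
          (swapT b mα (mh.mul (mH.pow_const _).inv)).symm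
      _ ≤ ∫⁻ u in IbSet b, cp p * (f u ^ p * m u) := by
          refine setLIntegral_mono' (Ib_meas b) fun u hu => ?_
          have hH0 := HH.pos u hu
          have hHt := HH.fin u hu
          have hB1 : B u ≤ H u := hBH u hu
          calc f u ^ p * m u * B u ^ (p - 1) * ∫⁻ s in Ioo 0 u, h s * (H s ^ p)⁻¹
              ≤ f u ^ p * m u * H u ^ (p - 1) * (cp p * (H u ^ (p - 1))⁻¹) := by
                gcongr
                exact HH.high unb hu hp
            _ = cp p * (f u ^ p * m u) * (H u ^ (p - 1) * (H u ^ (p - 1))⁻¹) := by ring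
            _ = _ := by
              rw [ENNReal.mul_inv_cancel (by simp [hH0, hHt]) (by simp [hH0, hHt]), mul_one]
      _ = _ := lintegral_const_mul'' _ ((mf.pow_const _).mul HB.mh.aemeasurable)
  calc ∫⁻ t in IbSet b, f t * g t * (B t / H t) ^ (e + 1)
      ≤ ∫⁻ t in IbSet b, 2 * 2 ^ (e + 2) * (g t * ∫⁻ s in Ioo 0 t, k s) := by
        refine setLIntegral_mono' (Ib_meas b) fun t ht => ?_
        calc f t * g t * (B t / H t) ^ (e + 1) = g t * (f t * (B t / H t) ^ (e + 1)) := by ring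
          _ ≤ g t * (2 * 2 ^ (e + 2) * ∫⁻ s in Ioo 0 t, k s) := mul_le_mul_right (key t ht) _
          _ = _ := by ring
    _ = 2 * 2 ^ (e + 2) * ∫⁻ t in IbSet b, g t * ∫⁻ s in Ioo 0 t, k s := by
        rw [lintegral_const_mul']
        exact ENNReal.mul_ne_top (by simp) (ENNReal.rpow_ne_top_of_nonneg (by positivity) (by simp))
    _ = 2 * 2 ^ (e + 2) * ∫⁻ s in IbSet b, (X * fun s => G s * ψ s ^ e) s := by
        rw [swapT b hg.aemeasurable mk]
        congr 1
        refine lintegral_congr fun s => ?_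
        simp only [hk, Pi.mul_apply]
        change X s * ψ s ^ e * G s = _
        ring
    _ ≤ 2 * 2 ^ (e + 2) * ((∫⁻ s in IbSet b, X s ^ p) ^ (1 / p) *
          (∫⁻ s in IbSet b, (G s * ψ s ^ e) ^ q) ^ (1 / q)) := by
        gcongr
        exact ENNReal.lintegral_mul_le_Lp_mul_Lq _ hpq mX.aemeasurable
          (mG.mul (mψ.pow_const _)).aemeasurable
    _ ≤ 2 * 2 ^ (e + 2) * ((cp p * ∫⁻ t in IbSet b, f t ^ p * m t) ^ (1 / p) *
          (∫⁻ t in IbSet b, G t ^ q * ψ t) ^ e) := by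
        have e2 : ∀ s, (G s * ψ s ^ e) ^ q = G s ^ q * ψ s := by
          intro s
          rw [ENNReal.mul_rpow_of_nonneg _ _ hq0.le, ← ENNReal.rpow_mul, mul_comm e q, hqe,
            ENNReal.rpow_one]
        simp only [e2]
        gcongr
    _ = _ := by
        rw [ENNReal.mul_rpow_of_nonneg _ _ (by positivity)]
        ring

lemma Hker {b : ℝ≥0∞} {φ : ℝ → ℝ≥0∞} {p : ℝ} (mφ : Measurable φ) {t : ℝ} (ht : t ∈ IbSet b) :
    intPhi φ t * ENNReal.ofReal (t ^ (-p)) + tailP b p φ t =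
      ∫⁻ u in IbSet b, φ u * ENNReal.ofReal ((max t u) ^ (-p)) := by
  have h1 : IbSet b = Ioc 0 t ∪ Tb b t := by
    ext x; constructor
    · intro hx
      rcases le_or_gt x t with h | h
      · exact Or.inl ⟨hx.1, h⟩
      · exact Or.inr ⟨h, hx.2⟩
    · rintro (hx | hx)
      · exact Ib_mid ht hx.1 hx.2
      · exact Tb_sub ht hx
  have hd : Disjoint (Ioc 0 t) (Tb b t) := by
    rw [Set.disjoint_left]; intro x hx hy; exact absurd hx.2 (not_le.2 hy.1)
  rw [h1, lintegral_union (Tb_meas b t) hd]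
  congr 1
  · rw [intPhi, ← lintegral_mul_const _ mφ, setLIntegral_congr Ioo_ae_eq_Ioc]
    refine setLIntegral_congr_fun measurableSet_Ioc fun u hu => ?_
    simp only [max_eq_left hu.2]
  · rw [tailP]
    refine setLIntegral_congr_fun (Tb_meas b t) fun u hu => ?_
    simp only [max_eq_right hu.1.le]

lemma Heq {b : ℝ≥0∞} {φ : ℝ → ℝ≥0∞} {p : ℝ} (hp : 1 < p) (mφ : Measurable φ) {t r : ℝ}
    (ht : t ∈ IbSet b) (hr : r ∈ IbSet b) (htr : t ≤ r) :
    intPhi φ t * ENNReal.ofReal (t ^ (-p)) + tailP b p φ t =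
      intPhi φ r * ENNReal.ofReal (r ^ (-p)) + tailP b p φ r +
        ∫⁻ s in Ioc t r, ENNReal.ofReal (p * s ^ (-p - 1)) * intPhi φ s := by
  rw [Hker mφ ht, Hker mφ hr]
  set κ : ℝ → ℝ≥0∞ := fun s => ENNReal.ofReal (p * s ^ (-p - 1)) with hκ
  have mκ : Measurable κ := by
    apply ENNReal.measurable_ofReal.comp
    fun_prop
  have hm : Measurable (Function.uncurry fun u s : ℝ =>
      (Iio s).indicator (fun u => φ u * κ s) u) := by
    have : (Function.uncurry fun u s : ℝ => (Iio s).indicator (fun u => φ u * κ s) u) =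
        {q : ℝ × ℝ | q.1 < q.2}.indicator (fun q => φ q.1 * κ q.2) := by
      ext ⟨t, s⟩
      simp [indicator, Function.uncurry]
    rw [this]
    exact ((mφ.comp measurable_fst).mul (mκ.comp measurable_snd)).indicator
      (measurableSet_lt measurable_fst measurable_snd)
  have h1 : ∀ u ∈ IbSet b, φ u * ENNReal.ofReal ((max t u) ^ (-p)) =
      φ u * ENNReal.ofReal ((max r u) ^ (-p)) +
        ∫⁻ s in Ioc t r, (Iio s).indicator (fun u => φ u * κ s) u := by
    intro u hu
    have e1 : ∫⁻ s in Ioc t r, (Iio s).indicator (fun u => φ u * κ s) u =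
        φ u * ∫⁻ s in Ioc (max t u) r, κ s := by
      have : Ioc (max t u) r = Ioi u ∩ Ioc t r := by
        ext x; simp [and_comm, and_assoc, and_left_comm]
      rw [← lintegral_const_mul _ mκ, this, ← Measure.restrict_restrict measurableSet_Ioi,
        ← lintegral_indicator measurableSet_Ioi]
      refine lintegral_congr fun s => ?_
      simp [indicator]
    rw [e1, ← mul_add]
    congr 1
    rcases le_total u r with h | h
    · rw [max_eq_left h]
      exact J_int hp (lt_max_of_lt_left ht.1) (max_le htr h)
    · rw [max_eq_right h, max_eq_right (htr.trans h), Ioc_eq_empty (not_lt.2 h)]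
      simp
  rw [setLIntegral_congr_fun (Ib_meas b) h1, lintegral_add_left]
  · congr 1
    rw [lintegral_lintegral_swap hm.aemeasurable]
    refine setLIntegral_congr_fun measurableSet_Ioc fun s hs => ?_
    have hsI : s ∈ IbSet b := Ib_mid hr (ht.1.trans hs.1) hs.2
    have h2 : Ioo 0 s = Iio s ∩ IbSet b := by
      ext x; constructor
      · intro hx; exact ⟨hx.2, Ib_mid hsI hx.1 hx.2.le⟩
      · intro hx; exact ⟨hx.2.1, hx.1⟩
    change _ = κ s * intPhi φ s
    rw [lintegral_indicator measurableSet_Iio, Measure.restrict_restrict measurableSet_Iio, ← h2,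
      lintegral_mul_const _ mφ, intPhi, mul_comm]
  · refine mφ.mul (ENNReal.measurable_ofReal.comp ?_)
    fun_prop

lemma D_top {b : ℝ≥0∞} {p : ℝ} {φ : ℝ → ℝ≥0∞} (hp : 1 < p) (hφ : IsWeight b φ)
    (hn : ¬ ∀ t ∈ IbSet b, intPhi φ t ≠ ⊤ ∧ tailP b p φ t ≠ ⊤) {t : ℝ} (ht : t ∈ IbSet b) :
    DPhi b p φ t = ⊤ := by
  obtain ⟨mφ, -, hloc⟩ := hφ
  push Not at hn
  obtain ⟨r, hr, hrt⟩ := hn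
  unfold DPhi
  by_cases hA : intPhi φ r = ⊤
  · have : intPhi φ t = ⊤ := by
      rcases le_total r t with h | h
      · exact top_le_iff.1 (hA ▸ lintegral_mono_set (Ioo_subset_Ioo_right h))
      · have hsub : Ioo 0 r ⊆ Ioo 0 t ∪ Icc t r := by
          intro x hx
          rcases lt_or_ge x t with h' | h'
          · exact Or.inl ⟨hx.1, h'⟩
          · exact Or.inr ⟨h', hx.2.le⟩
        have h1 : intPhi φ r ≤ intPhi φ t + ∫⁻ s in Icc t r, φ s :=
          (lintegral_mono_set hsub).trans (lintegral_union_le _ _ _)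
        rw [hA, top_le_iff, ENNReal.add_eq_top] at h1
        exact h1.resolve_right (hloc t r ht.1 hr.2).ne
    simp [this]
  · have hB := hrt hA
    have : tailP b p φ t = ⊤ := by
      rcases le_total t r with h | h
      · exact top_le_iff.1 (hB ▸ lintegral_mono_set (Tb_anti b h))
      · have hsub : Tb b r ⊆ Icc r t ∪ Tb b t := by
          intro x hx
          rcases le_or_gt x t with h' | h'
          · exact Or.inl ⟨hx.1.le, h'⟩
          · exact Or.inr ⟨h', hx.2⟩
        have h1 : tailP b p φ r ≤ (∫⁻ s in Icc r t, φ s * ENNReal.ofReal (s ^ (-p))) +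
            tailP b p φ t :=
          (lintegral_mono_set hsub).trans (lintegral_union_le _ _ _)
        rw [hB, top_le_iff, ENNReal.add_eq_top] at h1
        refine h1.resolve_left (ne_top_of_le_ne_top (b :=
          (∫⁻ s in Icc r t, φ s) * ENNReal.ofReal (r ^ (-p))) ?_ ?_)
        · exact ENNReal.mul_ne_top (hloc r t hr.1 ht.2).ne ENNReal.ofReal_ne_top
        · rw [← lintegral_mul_const _ mφ]
          refine setLIntegral_mono' measurableSet_Icc fun s hs => ?_
          have := Real.rpow_le_rpow_of_nonpos hr.1 hs.1 (show -p ≤ 0 by linarith)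
          gcongr
    have h0 : ENNReal.ofReal (t ^ p) ≠ 0 := by
      simpa using Real.rpow_pos_of_pos ht.1 p
    rw [this, ENNReal.mul_top h0]
    simp

lemma PQp_eq {b : ℝ≥0∞} {p : ℝ} {φ : ℝ → ℝ≥0∞} {t : ℝ} (ht : 0 < t) :
    PQp b p φ t = ENNReal.ofReal (t ^ (p - 1)) *
      (intPhi φ t * ENNReal.ofReal (t ^ (-p)) + tailP b p φ t) := by
  have e1 : (ENNReal.ofReal t)⁻¹ = ENNReal.ofReal (t ^ (p - 1)) * ENNReal.ofReal (t ^ (-p)) := by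
    rw [← ENNReal.ofReal_mul (by positivity), ← Real.rpow_add ht, ← ENNReal.ofReal_inv_of_pos ht,
      ← Real.rpow_neg_one]
    congr 2; ring
  have e2 : ENNReal.ofReal (t ^ (-p)) * ENNReal.ofReal (t ^ p) = 1 := by
    rw [← ENNReal.ofReal_mul (by positivity), ← Real.rpow_add ht]; simp
  rw [PQp, DPhi, e1]
  calc _ = ENNReal.ofReal (t ^ (p - 1)) * (intPhi φ t * ENNReal.ofReal (t ^ (-p)) +
        ENNReal.ofReal (t ^ (-p)) * ENNReal.ofReal (t ^ p) * tailP b p φ t) := by ring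
    _ = _ := by rw [e2, one_mul]

lemma Qp_eq {b : ℝ≥0∞} {p : ℝ} {φ : ℝ → ℝ≥0∞} {t : ℝ} (hp : 1 < p) :
    Qp b p φ t = ENNReal.ofReal (t ^ (p - 1)) * (ENNReal.ofReal p * tailP b p φ t) := by
  rw [Qp, ENNReal.ofReal_mul (by linarith), tailP]
  ring

lemma ratio_eq {b : ℝ≥0∞} {p : ℝ} {φ : ℝ → ℝ≥0∞} {t : ℝ} (hp : 1 < p) (ht : 0 < t) :
    Qp b p φ t / PQp b p φ t = ENNReal.ofReal p * (tailP b p φ t /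
      (intPhi φ t * ENNReal.ofReal (t ^ (-p)) + tailP b p φ t)) := by
  have h0 : ENNReal.ofReal (t ^ (p - 1)) ≠ 0 := by
    simpa using Real.rpow_pos_of_pos ht _
  rw [Qp_eq hp, PQp_eq ht, ENNReal.mul_div_mul_left _ _ h0 ENNReal.ofReal_ne_top, mul_div_assoc]

lemma dual_eq {b : ℝ≥0∞} {p : ℝ} {φ : ℝ → ℝ≥0∞} {t : ℝ} (hp : 1 < p) (ht : 0 < t) :
    dualWeight' b p φ t = ENNReal.ofReal (p * t ^ (-p - 1)) * intPhi φ t * tailP b p φ t /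
      (intPhi φ t * ENNReal.ofReal (t ^ (-p)) + tailP b p φ t) ^ (p / (p - 1) + 1) := by
  have hp1 : 0 < p - 1 := by linarith
  have hq : 0 < p / (p - 1) + 1 := by positivity
  have e1 : ENNReal.ofReal (t ^ (p - 1)) ^ (p / (p - 1) + 1) = ENNReal.ofReal (t ^ (2 * p - 1)) := by
    rw [ENNReal.ofReal_rpow_of_pos (by positivity), ← Real.rpow_mul ht.le]
    congr 2
    field_simp
    ring
  have e2 : (ENNReal.ofReal t)⁻¹ * ENNReal.ofReal (t ^ (p - 1)) * ENNReal.ofReal p =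
      ENNReal.ofReal (t ^ (2 * p - 1)) * ENNReal.ofReal (p * t ^ (-p - 1)) := by
    rw [← ENNReal.ofReal_inv_of_pos ht, ← ENNReal.ofReal_mul (by positivity),
      ← ENNReal.ofReal_mul (by positivity), ← ENNReal.ofReal_mul (by positivity),
      ← Real.rpow_neg_one, ← Real.rpow_add ht]
    congr 1
    rw [mul_left_comm, ← Real.rpow_add ht, mul_comm]
    congr 2; ring
  have h0 : ENNReal.ofReal (t ^ (2 * p - 1)) ≠ 0 := by
    simpa using Real.rpow_pos_of_pos ht _
  rw [dualWeight', Qp_eq hp, PQp_eq ht, ENNReal.mul_rpow_of_nonneg _ _ hq.le, e1, Pavg]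
  change (ENNReal.ofReal t)⁻¹ * intPhi φ t * _ / _ = _
  rw [show (ENNReal.ofReal t)⁻¹ * intPhi φ t * (ENNReal.ofReal (t ^ (p - 1)) *
      (ENNReal.ofReal p * tailP b p φ t)) = ((ENNReal.ofReal t)⁻¹ * ENNReal.ofReal (t ^ (p - 1)) *
      ENNReal.ofReal p) * (intPhi φ t * tailP b p φ t) by ring, e2, mul_assoc,
      ENNReal.mul_div_mul_left _ _ h0 ENNReal.ofReal_ne_top, mul_assoc]

theorem statement3 (p : ℝ) (hp : 1 < p) (b : ℝ≥0∞) (hb : 0 < b)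
    (φ : ℝ → ℝ≥0∞) (hφ : IsNontrivialWeight b p φ) :
    ∃ C : ℝ, 0 < C ∧ ∀ f g : ℝ → ℝ≥0∞, MonotoneOn f (IbSet b) → Measurable g →
      ∫⁻ t in IbSet b, f t * g t * (Qp b p φ t / PQp b p φ t) ^ (1 / (p / (p - 1)) + 1) ≤
        ENNReal.ofReal C * (∫⁻ t in IbSet b, f t ^ p * φ t * ENNReal.ofReal (t ^ (-p))) ^ (1 / p) *
          (∫⁻ t in IbSet b,
            (∫⁻ s in {s : ℝ | t < s ∧ ENNReal.ofReal s < b}, g s) ^ (p / (p - 1)) *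
              dualWeight' b p φ t) ^ (1 / (p / (p - 1))) := by
  obtain ⟨hw, -, hnt⟩ := hφ
  have hp0 : 0 < p := by linarith
  have hp1 : 0 < p - 1 := by linarith
  have he : 0 < 1 / (p / (p - 1)) + 1 := by positivity
  by_cases hfin : ∀ t ∈ IbSet b, intPhi φ t ≠ ⊤ ∧ tailP b p φ t ≠ ⊤
  swap
  · refine ⟨1, one_pos, fun f g _ _ => ?_⟩
    have h0 : ∫⁻ t in IbSet b, f t * g t *
        (Qp b p φ t / PQp b p φ t) ^ (1 / (p / (p - 1)) + 1) = 0 := by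
      rw [setLIntegral_congr_fun (g := fun _ => 0) (Ib_meas b) fun t ht => ?_]
      · simp
      · have : PQp b p φ t = ⊤ := by
          rw [PQp, D_top hp hw hfin ht, ENNReal.mul_top (by simp)]
        simp only [this, ENNReal.div_top, ENNReal.zero_rpow_of_pos he, mul_zero]
    rw [h0]
    exact zero_le
  obtain ⟨mφ, hpos, hloc⟩ := hw
  set m : ℝ → ℝ≥0∞ := fun s => φ s * ENNReal.ofReal (s ^ (-p)) with hm
  set H : ℝ → ℝ≥0∞ := fun t => intPhi φ t * ENNReal.ofReal (t ^ (-p)) + tailP b p φ t with hH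
  set h : ℝ → ℝ≥0∞ := fun s => ENNReal.ofReal (p * s ^ (-p - 1)) * intPhi φ s with hh
  have mpow : ∀ e : ℝ, Measurable fun s : ℝ => ENNReal.ofReal (s ^ e) := fun e =>
    ENNReal.measurable_ofReal.comp (by fun_prop)
  have mm : Measurable m := mφ.mul (mpow _)
  have mA : Measurable (intPhi φ) :=
    Monotone.measurable fun s t hst => lintegral_mono_set (Ioo_subset_Ioo_right hst)
  have mB : Measurable (tailP b p φ) :=
    Antitone.measurable fun s t hst => lintegral_mono_set (Tb_anti b hst)
  have mh : Measurable h := (ENNReal.measurable_ofReal.comp (by fun_prop)).mul mA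
  have mH : Measurable H := (mA.mul (mpow _)).add mB
  have hBpos : ∀ t ∈ IbSet b, tailP b p φ t ≠ 0 := by
    intro t ht
    have h1 : 0 < ∫⁻ s in Tb b t, m s := by
      rw [setLIntegral_pos_iff mm]
      have hsub : Tb b t ⊆ Function.support m ∩ Tb b t := by
        intro s hs
        refine ⟨?_, hs⟩
        have hs' := Tb_sub ht hs
        refine mul_ne_zero (hpos s hs').1.ne' ?_
        simpa using Real.rpow_pos_of_pos hs'.1 _
      refine lt_of_lt_of_le ?_ (measure_mono hsub)
      have ho : IsOpen (Tb b t) :=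
        isOpen_Ioi.inter (isOpen_Iio.preimage ENNReal.continuous_ofReal)
      refine ho.measure_pos _ ?_
      obtain ⟨c, hc1, hc2⟩ := exists_between ht.2
      have hct : c ≠ ⊤ := hc2.ne_top
      exact ⟨c.toReal, (ENNReal.ofReal_lt_iff_lt_toReal ht.1.le hct).1 hc1,
        by rwa [ENNReal.ofReal_toReal hct]⟩
    exact h1.ne'
  have HB : DecPrim b (fun t => ∫⁻ s in Tb b t, m s) m := by
    refine ⟨mB, mm, fun t ht => (hfin t ht).2, hBpos, ?_⟩
    intro t ht r hr htr
    have h1 : Tb b t = Tb b r ∪ Ioc t r := by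
      ext x; constructor
      · intro hx
        rcases le_or_gt x r with h | h
        · exact Or.inr ⟨hx.1, h⟩
        · exact Or.inl ⟨h, hx.2⟩
      · rintro (hx | hx)
        · exact Tb_anti b htr hx
        · exact ⟨hx.1, (ENNReal.ofReal_le_ofReal hx.2).trans_lt hr.2⟩
    have hd : Disjoint (Tb b r) (Ioc t r) := by
      rw [Set.disjoint_left]; intro x hx hy; exact absurd hy.2 (not_le.2 hx.1)
    change ∫⁻ s in Tb b t, m s = _
    rw [h1, lintegral_union measurableSet_Ioc hd]
  have HH : DecPrim b H h := by
    refine ⟨mH, mh, fun t ht => ?_, fun t ht h0 => ?_, fun t ht r hr htr => Heq hp mφ ht hr htr⟩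
    · exact ENNReal.add_ne_top.2 ⟨ENNReal.mul_ne_top (hfin t ht).1 ENNReal.ofReal_ne_top,
        (hfin t ht).2⟩
    · exact hBpos t ht (add_eq_zero.1 h0).2
  have hBH : ∀ t ∈ IbSet b, ∫⁻ s in Tb b t, m s ≤ H t := fun t _ => le_add_self
  have unb : ∀ M : ℝ≥0∞, M ≠ ⊤ → ∃ t ∈ IbSet b, M ≤ H t := by
    intro M hM
    obtain ⟨r, hr, h1⟩ := Ib_exh b m (y := M) (by
      change M < tailP b p φ 0
      rw [hnt]; exact hM.lt_top)
    exact ⟨r, hr, h1.le.trans (hBH r hr)⟩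
  set K : ℝ≥0∞ := ENNReal.ofReal p ^ (1 / (p / (p - 1)) + 1) * cc p with hK
  have hpt : ENNReal.ofReal p ^ (1 / (p / (p - 1)) + 1) ≠ ⊤ :=
    ENNReal.rpow_ne_top_of_nonneg he.le ENNReal.ofReal_ne_top
  have hKt : K ≠ ⊤ := by
    refine ENNReal.mul_ne_top hpt (ENNReal.mul_ne_top (ENNReal.mul_ne_top (by simp) ?_) ?_)
    · exact ENNReal.rpow_ne_top_of_nonneg (by positivity) (by simp)
    · exact ENNReal.rpow_ne_top_of_nonneg (by positivity) (cp_ne_top hp)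
  refine ⟨K.toReal + 1, by positivity, fun f g hf hg => ?_⟩
  have hKle : K ≤ ENNReal.ofReal (K.toReal + 1) := by
    rw [← ENNReal.ofReal_toReal hKt, ENNReal.toReal_ofReal ENNReal.toReal_nonneg]
    exact ENNReal.ofReal_le_ofReal (by linarith)
  have hcore := core hp HB HH unb hBH hf hg
  have hL : ∫⁻ t in IbSet b, f t * g t * (Qp b p φ t / PQp b p φ t) ^ (1 / (p / (p - 1)) + 1) =
      ENNReal.ofReal p ^ (1 / (p / (p - 1)) + 1) * ∫⁻ t in IbSet b, f t * g t *
        ((∫⁻ s in Tb b t, m s) / H t) ^ (1 / (p / (p - 1)) + 1) := by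
    rw [← lintegral_const_mul' _ _ hpt]
    refine setLIntegral_congr_fun (Ib_meas b) fun t ht => ?_
    simp only [ratio_eq hp ht.1]
    rw [ENNReal.mul_rpow_of_nonneg _ _ he.le]
    change f t * g t * (_ * (tailP b p φ t / H t) ^ (1 / (p / (p - 1)) + 1)) =
      _ * (f t * g t * (tailP b p φ t / H t) ^ (1 / (p / (p - 1)) + 1))
    ring
  have hR1 : ∫⁻ t in IbSet b, f t ^ p * φ t * ENNReal.ofReal (t ^ (-p)) =
      ∫⁻ t in IbSet b, f t ^ p * m t := by
    simp only [hm, mul_assoc]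
  have hR2 : ∫⁻ t in IbSet b, (∫⁻ s in {s : ℝ | t < s ∧ ENNReal.ofReal s < b}, g s) ^
        (p / (p - 1)) * dualWeight' b p φ t =
      ∫⁻ t in IbSet b, (∫⁻ s in Tb b t, g s) ^ (p / (p - 1)) *
          (h t * (∫⁻ s in Tb b t, m s) / H t ^ (p / (p - 1) + 1)) := by
    refine setLIntegral_congr_fun (Ib_meas b) fun t ht => ?_
    simp only [dual_eq hp ht.1]
    rfl
  rw [hL, hR1, hR2]
  calc _ ≤ ENNReal.ofReal p ^ (1 / (p / (p - 1)) + 1) * _ := mul_le_mul_right hcore _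
    _ = K * (∫⁻ t in IbSet b, f t ^ p * m t) ^ (1 / p) *
        (∫⁻ t in IbSet b, (∫⁻ s in Tb b t, g s) ^ (p / (p - 1)) *
          (h t * (∫⁻ s in Tb b t, m s) / H t ^ (p / (p - 1) + 1))) ^ (1 / (p / (p - 1))) := by
        rw [hK]; ring
    _ ≤ _ := by gcongr

end
end
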